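/- Let u ∈ C⁴(Q̄_T) be an admissible solution of equation (E). Assume (f1), (f2), (f5), (A2), (A4), and that there exists u̲ satisfying (sub) with constant δ₀ > 0. Then for every K > 0 there exists a constant C₁ > 0, depending only on n, Ω, T, f, Γ, A, ψ, δ₀ and K, such that whenever |u|_{C¹_x(Q̄_T)} ≤ K and |u̲|_{C²(Q̄_T)} ≤ K, the global second-derivative estimate max_{Q̄_T} |D²u| ≤ C₁ (1 + max_{𝒫Q_T} |D²u|) holds. -/

import Mathlib

open scoped BigOperators Topology

noncomputable section

namespace ParabolicHessian

/-- Square real matrices of size `n`. -/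
abbrev Mat (n : ℕ) := Matrix (Fin n) (Fin n) ℝ

/-- Eigenvalue vector of a real matrix (junk value `0` if not symmetric). -/
def eigenVec {n : ℕ} (S : Mat n) : Fin n → ℝ :=
  if h : S.IsHermitian then h.eigenvalues else 0

/-- Spatial gradient of `v : ℝⁿ → ℝ`. -/
def sgrad {n : ℕ} (v : (Fin n → ℝ) → ℝ) (x : Fin n → ℝ) : Fin n → ℝ :=
  fun i => fderiv ℝ v x (Pi.single i 1)

/-- Spatial Hessian of `v : ℝⁿ → ℝ`, as a matrix. -/
def shess {n : ℕ} (v : (Fin n → ℝ) → ℝ) (x : Fin n → ℝ) : Mat n :=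
  Matrix.of fun i j => fderiv ℝ (fun y => fderiv ℝ v y (Pi.single j 1)) x (Pi.single i 1)

/-- Quadratic form `ξᵀ S ξ`. -/
def qform {n : ℕ} (S : Mat n) (ξ : Fin n → ℝ) : ℝ :=
  ∑ i, ∑ j, ξ i * S i j * ξ j

/-- Norm of a matrix (sup norm on `Fin n → Fin n → ℝ`). -/
def matNorm {n : ℕ} (S : Mat n) : ℝ := ‖(fun i j => S i j : Fin n → Fin n → ℝ)‖

/-- The parabolic cylinder `Q_T = Ω × (0,T]`. -/
def QT {n : ℕ} (Ω : Set (Fin n → ℝ)) (T : ℝ) : Set ((Fin n → ℝ) × ℝ) :=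
  Ω ×ˢ Set.Ioc 0 T

/-- `Q̄_T = Ω̄ × [0,T]`. -/
def QTbar {n : ℕ} (Ω : Set (Fin n → ℝ)) (T : ℝ) : Set ((Fin n → ℝ) × ℝ) :=
  closure Ω ×ˢ Set.Icc 0 T

/-- The parabolic boundary `𝒫Q_T = (Ω̄ × {0}) ∪ (∂Ω × [0,T])`. -/
def PQ {n : ℕ} (Ω : Set (Fin n → ℝ)) (T : ℝ) : Set ((Fin n → ℝ) × ℝ) :=
  (closure Ω ×ˢ ({0} : Set ℝ)) ∪ (frontier Ω ×ˢ Set.Icc 0 T)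

/-- `Ω` has smooth boundary (encoded via a smooth defining function). -/
def SmoothBoundary {n : ℕ} (Ω : Set (Fin n → ℝ)) : Prop :=
  ∃ ρ : (Fin n → ℝ) → ℝ, ContDiff ℝ (⊤ : ℕ∞) ρ ∧ Ω = {x | ρ x < 0} ∧
    ∀ x ∈ frontier Ω, fderiv ℝ ρ x ≠ 0

/-- `Γ` is an open convex symmetric proper cone with vertex `0`
containing the positive cone. -/
def GoodCone {n : ℕ} (Γ : Set (Fin n → ℝ)) : Prop :=
  IsOpen Γ ∧ Convex ℝ Γ ∧ (∀ lam ∈ Γ, ∀ s : ℝ, 0 < s → s • lam ∈ Γ) ∧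
    (∀ σ : Equiv.Perm (Fin n), ∀ lam ∈ Γ, lam ∘ σ ∈ Γ) ∧
    {lam : Fin n → ℝ | ∀ i, 0 < lam i} ⊆ Γ ∧ Γ ≠ Set.univ

/-- `f` is smooth and symmetric on `Γ`. -/
def SmoothSymF {n : ℕ} (Γ : Set (Fin n → ℝ)) (f : (Fin n → ℝ) → ℝ) : Prop :=
  ContDiffOn ℝ (⊤ : ℕ∞) f Γ ∧ ∀ σ : Equiv.Perm (Fin n), ∀ lam ∈ Γ, f (lam ∘ σ) = f lam

/-- `f_i = ∂f/∂λ_i`. -/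
def fLam {n : ℕ} (f : (Fin n → ℝ) → ℝ) (lam : Fin n → ℝ) (i : Fin n) : ℝ :=
  fderiv ℝ f lam (Pi.single i 1)

/-- (f1): `∂f/∂λ_i > 0` on `Γ`. -/
def F1cond {n : ℕ} (Γ : Set (Fin n → ℝ)) (f : (Fin n → ℝ) → ℝ) : Prop :=
  ∀ lam ∈ Γ, ∀ i, 0 < fLam f lam i

/-- (f2): `f` is concave on `Γ`. -/
def F2cond {n : ℕ} (Γ : Set (Fin n → ℝ)) (f : (Fin n → ℝ) → ℝ) : Prop :=
  ConcaveOn ℝ Γ f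

/-- (f5): `f > 0` on `Γ` and `f → 0` at every boundary point of `Γ`. -/
def F5cond {n : ℕ} (Γ : Set (Fin n → ℝ)) (f : (Fin n → ℝ) → ℝ) : Prop :=
  (∀ lam ∈ Γ, 0 < f lam) ∧
    ∀ lam₀ ∈ frontier Γ, Filter.Tendsto f (nhdsWithin lam₀ Γ) (nhds 0)

/-- `A(x,t,p)` is a smooth symmetric-matrix-valued function. -/
def ASmooth {n : ℕ} (A : (Fin n → ℝ) → ℝ → (Fin n → ℝ) → Mat n) : Prop :=
  (∀ x t p, (A x t p).IsSymm) ∧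
    ∀ i j, ContDiff ℝ (⊤ : ℕ∞)
      (fun q : ((Fin n → ℝ) × ℝ) × (Fin n → ℝ) => A q.1.1 q.1.2 q.2 i j)

/-- `ψ(x,t,z,p)` is smooth. -/
def PsiSmooth {n : ℕ} (ψ : (Fin n → ℝ) → ℝ → ℝ → (Fin n → ℝ) → ℝ) : Prop :=
  ContDiff ℝ (⊤ : ℕ∞)
    (fun q : ((Fin n → ℝ) × ℝ) × ℝ × (Fin n → ℝ) => ψ q.1.1 q.1.2 q.2.1 q.2.2)

/-- `u ∈ C^k`, jointly in `(x,t)`. -/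
def RegN {n : ℕ} (k : ℕ) (u : (Fin n → ℝ) → ℝ → ℝ) : Prop :=
  ContDiff ℝ (k : ℕ∞) fun q : (Fin n → ℝ) × ℝ => u q.1 q.2

/-- `u ∈ C^∞`, jointly in `(x,t)`. -/
def RegInf {n : ℕ} (u : (Fin n → ℝ) → ℝ → ℝ) : Prop :=
  ContDiff ℝ (⊤ : ℕ∞) fun q : (Fin n → ℝ) × ℝ => u q.1 q.2

/-- `U[u] = D²u + A(x,t,Du)`. -/
def Umat {n : ℕ} (A : (Fin n → ℝ) → ℝ → (Fin n → ℝ) → Mat n)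
    (u : (Fin n → ℝ) → ℝ → ℝ) (x : Fin n → ℝ) (t : ℝ) : Mat n :=
  shess (fun y => u y t) x + A x t (sgrad (fun y => u y t) x)

/-- `u` is admissible on `Q`: `λ(U[u]) ∈ Γ` on `Q`. -/
def Admissible {n : ℕ} (Γ : Set (Fin n → ℝ))
    (A : (Fin n → ℝ) → ℝ → (Fin n → ℝ) → Mat n)
    (u : (Fin n → ℝ) → ℝ → ℝ) (Q : Set ((Fin n → ℝ) × ℝ)) : Prop :=
  ∀ q ∈ Q, eigenVec (Umat A u q.1 q.2) ∈ Γ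

/-- Equation (E): `f(λ(D²u + A(x,t,Du))) − ∂ₜu = ψ(x,t,u,Du)` on `Q`. -/
def SolvesE {n : ℕ} (f : (Fin n → ℝ) → ℝ)
    (A : (Fin n → ℝ) → ℝ → (Fin n → ℝ) → Mat n)
    (ψ : (Fin n → ℝ) → ℝ → ℝ → (Fin n → ℝ) → ℝ)
    (u : (Fin n → ℝ) → ℝ → ℝ) (Q : Set ((Fin n → ℝ) × ℝ)) : Prop :=
  ∀ q ∈ Q, f (eigenVec (Umat A u q.1 q.2)) - deriv (u q.1) q.2
    = ψ q.1 q.2 (u q.1 q.2) (sgrad (fun y => u y q.2) q.1)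

/-- (A2): `−ψ` and `ξᵀAξ` are concave in `p`. -/
def A2cond {n : ℕ} (A : (Fin n → ℝ) → ℝ → (Fin n → ℝ) → Mat n)
    (ψ : (Fin n → ℝ) → ℝ → ℝ → (Fin n → ℝ) → ℝ) : Prop :=
  (∀ x t z, ConcaveOn ℝ Set.univ fun p : Fin n → ℝ => -(ψ x t z p)) ∧
    ∀ x t (ξ : Fin n → ℝ), ConcaveOn ℝ Set.univ fun p => qform (A x t p) ξ

/-- (A4): `ψ_z ≤ 0`. -/
def A4cond {n : ℕ} (ψ : (Fin n → ℝ) → ℝ → ℝ → (Fin n → ℝ) → ℝ) : Prop :=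
  ∀ x t z p, deriv (fun w => ψ x t w p) z ≤ 0

/-- (sub): `u̲` is an admissible strict subsolution with gap `δ₀` on `Q`. -/
def Subsol {n : ℕ} (Γ : Set (Fin n → ℝ)) (f : (Fin n → ℝ) → ℝ)
    (A : (Fin n → ℝ) → ℝ → (Fin n → ℝ) → Mat n)
    (ψ : (Fin n → ℝ) → ℝ → ℝ → (Fin n → ℝ) → ℝ) (δ₀ : ℝ)
    (ub : (Fin n → ℝ) → ℝ → ℝ) (Q : Set ((Fin n → ℝ) × ℝ)) : Prop :=
  Admissible Γ A ub Q ∧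
    ∀ q ∈ Q, f (eigenVec (Umat A ub q.1 q.2)) - deriv (ub q.1) q.2
      ≥ ψ q.1 q.2 (ub q.1 q.2) (sgrad (fun y => ub y q.2) q.1) + δ₀

/-- `F(h) := f(λ(h))` (extended to all of matrix space by symmetrizing `h`). -/
def Ffunc {n : ℕ} (f : (Fin n → ℝ) → ℝ) (h : Fin n → Fin n → ℝ) : ℝ :=
  f (eigenVec (Matrix.of fun i j => (h i j + h j i) / 2))

/-- `F^{ij} = ∂F/∂h_{ij}`, evaluated at the matrix `U`. -/
def Fmat {n : ℕ} (f : (Fin n → ℝ) → ℝ) (U : Mat n) : Mat n :=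
  Matrix.of fun i j =>
    fderiv ℝ (Ffunc f) (fun a b => U a b) (Pi.single i (Pi.single j 1))

/-- The linearized operator
`𝓛v = Σ F^{ij} ∂²v/∂x_i∂x_j + Σ_k (Σ F^{ij} ∂A^{ij}/∂p_k − ψ_{p_k}) ∂v/∂x_k − ∂ₜv`,
where the coefficients are evaluated at `u`. -/
def Lop {n : ℕ} (f : (Fin n → ℝ) → ℝ)
    (A : (Fin n → ℝ) → ℝ → (Fin n → ℝ) → Mat n)
    (ψ : (Fin n → ℝ) → ℝ → ℝ → (Fin n → ℝ) → ℝ)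
    (u v : (Fin n → ℝ) → ℝ → ℝ) (x : Fin n → ℝ) (t : ℝ) : ℝ :=
  (∑ i, ∑ j, Fmat f (Umat A u x t) i j * shess (fun y => v y t) x i j)
    + (∑ k, ((∑ i, ∑ j, Fmat f (Umat A u x t) i j *
          fderiv ℝ (fun p => A x t p i j) (sgrad (fun y => u y t) x) (Pi.single k 1))
        - fderiv ℝ (fun p => ψ x t (u x t) p) (sgrad (fun y => u y t) x) (Pi.single k 1))
        * sgrad (fun y => v y t) x k)
    - deriv (v x) t

/-- Pointwise bound for the `C¹_x` norm `|u| + |Du|` on `Q`. -/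
def C1xBound {n : ℕ} (u : (Fin n → ℝ) → ℝ → ℝ) (Q : Set ((Fin n → ℝ) × ℝ)) (K : ℝ) : Prop :=
  ∀ q ∈ Q, |u q.1 q.2| + ‖sgrad (fun y => u y q.2) q.1‖ ≤ K

/-- Pointwise bound for the `C²` norm `|v| + |Dv| + |D²v| + |∂ₜv|` on `Q`. -/
def C2Bound {n : ℕ} (v : (Fin n → ℝ) → ℝ → ℝ) (Q : Set ((Fin n → ℝ) × ℝ)) (K : ℝ) : Prop :=
  ∀ q ∈ Q, |v q.1 q.2| + ‖sgrad (fun y => v y q.2) q.1‖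
    + matNorm (shess (fun y => v y q.2) q.1) + |deriv (v q.1) q.2| ≤ K

/-- Bound `K` for all derivatives of `φ` of order ≤ `k₀` on `Q`. -/
def CkBound {n : ℕ} (k₀ : ℕ) (φ : (Fin n → ℝ) → ℝ → ℝ)
    (Q : Set ((Fin n → ℝ) × ℝ)) (K : ℝ) : Prop :=
  ∀ q ∈ Q, ∀ k : ℕ, k ≤ k₀ →
    ‖iteratedFDeriv ℝ k (fun p : (Fin n → ℝ) × ℝ => φ p.1 p.2) q‖ ≤ K

/-- First half of (A1): `p·∇_x(ξᵀAξ) ≤ ψ̄₁(x,t)|ξ|²(1+|p|^{γ₁})`. -/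
def A1a {n : ℕ} (A : (Fin n → ℝ) → ℝ → (Fin n → ℝ) → Mat n)
    (ψb1 : (Fin n → ℝ) → ℝ → ℝ) (γ₁ : ℝ) (Ω : Set (Fin n → ℝ)) (T : ℝ) : Prop :=
  ∀ x ∈ closure Ω, ∀ t ∈ Set.Icc (0 : ℝ) T, ∀ p ξ : Fin n → ℝ,
    fderiv ℝ (fun y => qform (A y t p) ξ) x p ≤ ψb1 x t * ‖ξ‖ ^ 2 * (1 + ‖p‖ ^ γ₁)

/-- Second half of (A1): `p·∇_xψ + |p|²ψ_z ≥ −ψ̄₂(x,t,z)(1+|p|^{γ₂})`. -/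
def A1b {n : ℕ} (ψ : (Fin n → ℝ) → ℝ → ℝ → (Fin n → ℝ) → ℝ)
    (ψb2 : (Fin n → ℝ) → ℝ → ℝ → ℝ) (γ₂ : ℝ) (Ω : Set (Fin n → ℝ)) (T : ℝ) : Prop :=
  ∀ x ∈ closure Ω, ∀ t ∈ Set.Icc (0 : ℝ) T, ∀ z : ℝ, ∀ p : Fin n → ℝ,
    fderiv ℝ (fun y => ψ y t z p) x p + ‖p‖ ^ 2 * deriv (fun w => ψ x t w p) z
      ≥ -(ψb2 x t z * (1 + ‖p‖ ^ γ₂))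

/-- (A3): strict concavity of `p ↦ ξᵀA(x,t,p)ξ`. -/
def A3cond {n : ℕ} (A : (Fin n → ℝ) → ℝ → (Fin n → ℝ) → Mat n) (c₀ : ℝ) : Prop :=
  ∀ x t (p ξ η : Fin n → ℝ),
    fderiv ℝ (fun q => fderiv ℝ (fun r => qform (A x t r) ξ) q η) p η
      ≤ -c₀ * ‖ξ‖ ^ 2 * ‖η‖ ^ 2 + c₀ * (∑ i, ξ i * η i) ^ 2



open scoped Matrix

/-! ### Second-order jets of curves -/

/-- The curve `φ` is differentiable, with value `a`, velocity `b` and acceleration `c` at `0`. -/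
def HasJet {F : Type*} [NormedAddCommGroup F] [NormedSpace ℝ F] (φ : ℝ → F) (a b c : F) : Prop :=
  ∃ φ' : ℝ → F, (∀ s, HasDerivAt φ (φ' s) s) ∧ φ 0 = a ∧ φ' 0 = b ∧ HasDerivAt φ' c 0

/-- Directional derivative of `g` along `v`, as a function of the base point. -/
def dd {X : Type*} [NormedAddCommGroup X] [NormedSpace ℝ X] (v : X) (g : X → ℝ) : X → ℝ :=
  fun q => fderiv ℝ g q v

section Jets

variable {F G : Type*} [NormedAddCommGroup F] [NormedSpace ℝ F]
  [NormedAddCommGroup G] [NormedSpace ℝ G]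

lemma HasJet.const (a : F) : HasJet (fun _ => a) a 0 0 :=
  ⟨fun _ => 0, fun s => hasDerivAt_const s a, rfl, rfl, hasDerivAt_const 0 0⟩

lemma HasJet.add {φ χ : ℝ → F} {a b c a' b' c' : F} (h : HasJet φ a b c) (h' : HasJet χ a' b' c') :
    HasJet (fun s => φ s + χ s) (a + a') (b + b') (c + c') := by
  obtain ⟨p, hp, h0, h1, h2⟩ := h
  obtain ⟨q, hq, k0, k1, k2⟩ := h'
  exact ⟨fun s => p s + q s, fun s => (hp s).add (hq s), by simp [h0, k0], by simp [h1, k1],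
    h2.add k2⟩

lemma HasJet.const_mul {φ : ℝ → ℝ} {a b c : ℝ} (r : ℝ) (h : HasJet φ a b c) :
    HasJet (fun s => r * φ s) (r * a) (r * b) (r * c) := by
  obtain ⟨p, hp, h0, h1, h2⟩ := h
  exact ⟨fun s => r * p s, fun s => (hp s).const_mul r, by simp [h0], by simp [h1],
    h2.const_mul r⟩

lemma HasJet.sub {φ χ : ℝ → ℝ} {a b c a' b' c' : ℝ} (h : HasJet φ a b c)
    (h' : HasJet χ a' b' c') :
    HasJet (fun s => φ s - χ s) (a - a') (b - b') (c - c') := by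
  simpa [sub_eq_add_neg] using h.add (h'.const_mul (-1))

lemma HasJet.mul {φ χ : ℝ → ℝ} {a b c a' b' c' : ℝ} (h : HasJet φ a b c)
    (h' : HasJet χ a' b' c') :
    HasJet (fun s => φ s * χ s) (a * a') (b * a' + a * b') (c * a' + 2 * (b * b') + a * c') := by
  obtain ⟨p, hp, h0, h1, h2⟩ := h
  obtain ⟨q, hq, k0, k1, k2⟩ := h'
  refine ⟨fun s => p s * χ s + φ s * q s, fun s => (hp s).mul (hq s), by simp [h0, k0],
    by simp [h0, h1, k0, k1], ?_⟩
  have := (h2.mul (hq 0)).add ((hp 0).mul k2)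
  rw [h0, h1, k0, k1] at this
  convert this using 1
  · rfl
  · ring

lemma HasJet.sum {ι : Type*} {s : Finset ι} {φ : ι → ℝ → F} {a b c : ι → F}
    (h : ∀ i ∈ s, HasJet (φ i) (a i) (b i) (c i)) :
    HasJet (fun r => ∑ i ∈ s, φ i r) (∑ i ∈ s, a i) (∑ i ∈ s, b i) (∑ i ∈ s, c i) := by
  classical
  induction s using Finset.induction_on with
  | empty => simpa using HasJet.const (0 : F)
  | insert i s hi ih =>
    simp only [Finset.sum_insert hi]
    exact (h i (Finset.mem_insert_self i s)).add
      (ih fun j hj => h j (Finset.mem_insert_of_mem hj))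

lemma HasJet.prodMk {φ : ℝ → F} {χ : ℝ → G} {a b c : F} {a' b' c' : G} (h : HasJet φ a b c)
    (h' : HasJet χ a' b' c') :
    HasJet (fun s => (φ s, χ s)) (a, a') (b, b') (c, c') := by
  obtain ⟨p, hp, h0, h1, h2⟩ := h
  obtain ⟨q, hq, k0, k1, k2⟩ := h'
  exact ⟨fun s => (p s, q s), fun s => (hp s).prodMk (hq s), by simp [h0, k0], by simp [h1, k1],
    h2.prodMk k2⟩

lemma HasJet.pi {ι : Type*} [Fintype ι] {φ : ι → ℝ → ℝ} {a b c : ι → ℝ}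
    (h : ∀ i, HasJet (φ i) (a i) (b i) (c i)) :
    HasJet (fun s i => φ i s) a b c := by
  choose p hp h0 h1 h2 using h
  exact ⟨fun s i => p i s, fun s => hasDerivAt_pi.2 fun i => hp i s, funext h0, funext h1,
    hasDerivAt_pi.2 h2⟩

lemma hasJet_line (q v : F) : HasJet (fun s : ℝ => q + s • v) q v 0 := by
  refine ⟨fun _ => v, fun s => ?_, by simp, rfl, hasDerivAt_const _ _⟩
  simpa using ((hasDerivAt_id s).smul_const v).const_add q

lemma HasJet.comp {g : F → ℝ} (hg : ContDiff ℝ 2 g) {γ : ℝ → F} {a b c : F}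
    (h : HasJet γ a b c) :
    HasJet (fun s => g (γ s)) (g a) (fderiv ℝ g a b)
      (fderiv ℝ (fderiv ℝ g) a b b + fderiv ℝ g a c) := by
  obtain ⟨p, hp, h0, h1, h2⟩ := h
  have hd : Differentiable ℝ g := hg.differentiable (by norm_num)
  have hd2 : Differentiable ℝ (fderiv ℝ g) :=
    (hg.fderiv_right (m := 1) (by norm_num)).differentiable (by norm_num)
  refine ⟨fun s => fderiv ℝ g (γ s) (p s),
    fun s => (hd (γ s)).hasFDerivAt.comp_hasDerivAt s (hp s), by simp [h0], by simp [h0, h1], ?_⟩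
  have h3 : HasDerivAt (fun s => fderiv ℝ g (γ s)) (fderiv ℝ (fderiv ℝ g) (γ 0) (p 0)) 0 :=
    (hd2 (γ 0)).hasFDerivAt.comp_hasDerivAt 0 (hp 0)
  have := h3.clm_apply h2
  rwa [h0, h1] at this

lemma HasJet.eq_zero_and_nonneg_of_isLocalMin {φ : ℝ → ℝ} {a b c : ℝ} (h : HasJet φ a b c)
    (hmin : IsLocalMin φ 0) : b = 0 ∧ 0 ≤ c := by
  obtain ⟨p, hp, h0, h1, h2⟩ := h
  have hb : b = 0 := by rw [← h1]; exact hmin.hasDerivAt_eq_zero (hp 0)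
  refine ⟨hb, ?_⟩
  by_contra! hc
  have hlt : deriv (deriv fun s => -φ s) 0 > 0 := by
    have : deriv (fun s => -φ s) = fun s => -p s := funext fun s => (hp s).neg.deriv
    rw [this, deriv.fun_neg, h2.deriv]; linarith
  have hz : deriv (fun s => -φ s) 0 = 0 := by
    rw [deriv.fun_neg, (hp 0).deriv, h1, hb, neg_zero]
  have hm2 := isLocalMin_of_deriv_deriv_pos hlt hz (hp 0).neg.continuousAt
  have hconst : ∀ᶠ s in 𝓝 (0 : ℝ), φ s = φ 0 := by
    filter_upwards [hmin, hm2] with s h3 h4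
    linarith
  have hp0 : ∀ᶠ s in 𝓝 (0 : ℝ), p s = 0 := by
    filter_upwards [hconst.eventually_nhds] with s hs
    have : HasDerivAt φ 0 s := (hasDerivAt_const s (φ 0)).congr_of_eventuallyEq hs
    exact (hp s).unique this
  have : HasDerivAt p 0 0 := (hasDerivAt_const 0 (0 : ℝ)).congr_of_eventuallyEq hp0
  linarith [h2.unique this]

/-- First and second order conditions at a local maximum of `w · exp η`. -/
lemma mul_exp_localMax {w η : ℝ → ℝ} {w0 w1 w2 e0 e1 e2 : ℝ} (hw : HasJet w w0 w1 w2)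
    (he : HasJet η e0 e1 e2) (hmax : IsLocalMax (fun s => w s * Real.exp (η s)) 0) :
    w1 = -(w0 * e1) ∧ w2 + w0 * e2 - w0 * e1 ^ 2 ≤ 0 := by
  have hexp := HasJet.comp (g := Real.exp) (Real.contDiff_exp) he
  have hj := (hw.mul hexp).const_mul (-1)
  have hmin : IsLocalMin (fun s => -1 * (w s * Real.exp (η s))) 0 := by
    simpa using hmax.neg
  have hE := Real.exp_pos e0
  have d1 : ∀ x y : ℝ, fderiv ℝ Real.exp x y = y * Real.exp x := fun x y => by
    rw [fderiv_eq_smul_deriv, Real.deriv_exp, smul_eq_mul]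
  have d2 : fderiv ℝ (fderiv ℝ Real.exp) e0 e1 e1 = e1 * e1 * Real.exp e0 := by
    have hdd : Differentiable ℝ (fderiv ℝ Real.exp) :=
      ((Real.contDiff_exp (n := 2)).fderiv_right (m := 1) (by norm_num)).differentiable
        (by norm_num)
    have : HasFDerivAt (fun x => fderiv ℝ Real.exp x e1)
        ((fderiv ℝ (fderiv ℝ Real.exp) e0).flip e1) e0 := by
      simpa using (hdd e0).hasFDerivAt.clm_apply (hasFDerivAt_const e1 e0)
    have h2 : fderiv ℝ (fderiv ℝ Real.exp) e0 e1 e1 =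
        fderiv ℝ (fun x => fderiv ℝ Real.exp x e1) e0 e1 := by
      rw [this.fderiv]; rfl
    rw [h2, funext fun x => d1 x e1, fderiv_const_mul Real.differentiableAt_exp]
    simp [d1]; ring
  obtain ⟨h1, h2⟩ := hj.eq_zero_and_nonneg_of_isLocalMin hmin
  rw [d1] at h1
  rw [d1, d1, d2] at h2
  have hw1 : w1 = -(w0 * e1) := by
    have : (w1 + w0 * e1) * Real.exp e0 = 0 := by linarith
    rcases mul_eq_zero.1 this with h | h
    · linarith
    · exact absurd h hE.ne'
  refine ⟨hw1, ?_⟩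
  subst hw1
  by_contra! hcon
  have := mul_pos hcon hE
  nlinarith

lemma hasDerivAt_nonneg_of_le {φ : ℝ → ℝ} {b : ℝ} (h : HasDerivAt φ b 0)
    (hle : ∀ᶠ s in 𝓝[<] (0 : ℝ), φ s ≤ φ 0) : 0 ≤ b := by
  have ht := h.tendsto_slope_zero_left
  refine ge_of_tendsto ht ?_
  filter_upwards [hle, self_mem_nhdsWithin] with s hs hs0
  simp only [zero_add, smul_eq_mul]
  exact mul_nonneg_of_nonpos_of_nonpos (inv_nonpos.2 (le_of_lt hs0)) (by linarith)

end Jets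

section DirectionalDerivatives

variable {X : Type*} [NormedAddCommGroup X] [NormedSpace ℝ X]

lemma dd_contDiff {k : ℕ} {g : X → ℝ} (hg : ContDiff ℝ ((k + 1 : ℕ) : ℕ∞) g) (v : X) :
    ContDiff ℝ (k : ℕ∞) (dd v g) := by
  have : ContDiff ℝ (k : ℕ∞) (fderiv ℝ g) := hg.fderiv_right (by norm_cast)
  exact this.clm_apply contDiff_const

lemma dd_dd_eq {g : X → ℝ} (hg : ContDiff ℝ 2 g) (v w q : X) :
    dd v (dd w g) q = fderiv ℝ (fderiv ℝ g) q v w := by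
  have hdd : Differentiable ℝ (fderiv ℝ g) :=
    (hg.fderiv_right (m := 1) (by norm_num)).differentiable (by norm_num)
  have : HasFDerivAt (fun x => fderiv ℝ g x w) ((fderiv ℝ (fderiv ℝ g) q).flip w) q := by
    simpa using (hdd q).hasFDerivAt.clm_apply (hasFDerivAt_const w q)
  unfold dd
  rw [this.fderiv]; rfl

lemma dd_comm {g : X → ℝ} (hg : ContDiff ℝ 2 g) (v w : X) : dd v (dd w g) = dd w (dd v g) := by
  funext q
  rw [dd_dd_eq hg, dd_dd_eq hg]
  exact (hg.contDiffAt.isSymmSndFDerivAt (by simp)) v w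

lemma hasJet_along {g : X → ℝ} (hg : ContDiff ℝ 2 g) (q v : X) :
    HasJet (fun s : ℝ => g (q + s • v)) (g q) (dd v g q) (dd v (dd v g) q) := by
  rw [dd_dd_eq hg]
  change HasJet _ _ (fderiv ℝ g q v) _
  simpa only [map_zero, add_zero] using HasJet.comp hg (hasJet_line q v)

end DirectionalDerivatives

/-! ### Concave symmetric functions on cones and orthonormal frames -/

section Cone

variable {n : ℕ}

lemma sum_perm_of_orthogonal {O : Mat n} (hO : O * Oᵀ = 1) :
    ∃ w : Equiv.Perm (Fin n) → ℝ, (∀ σ, 0 ≤ w σ) ∧ ∑ σ, w σ = 1 ∧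
      ∀ μ : Fin n → ℝ, (fun i => ∑ k, O i k ^ 2 * μ k) = ∑ σ, w σ • (μ ∘ σ) := by
  have hO' : Oᵀ * O = 1 := mul_eq_one_comm.1 hO
  have hD : (Matrix.of fun i k => O i k ^ 2) ∈ doublyStochastic ℝ (Fin n) := by
    rw [mem_doublyStochastic_iff_sum]
    refine ⟨fun i j => sq_nonneg _, fun i => ?_, fun j => ?_⟩
    · have := congrFun (congrFun hO i) i
      simpa [Matrix.mul_apply, sq] using this
    · have := congrFun (congrFun hO' j) j
      simpa [Matrix.mul_apply, sq] using this
  obtain ⟨w, hw0, hw1, hw⟩ := exists_eq_sum_perm_of_mem_doublyStochastic hD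
  refine ⟨w, hw0, hw1, fun μ => funext fun i => ?_⟩
  have hik : ∀ k, O i k ^ 2 = ∑ σ, w σ * (if σ i = k then 1 else 0) := fun k => by
    have := congrFun (congrFun hw i) k
    simp only [Matrix.of_apply, Matrix.sum_apply, Matrix.smul_apply, smul_eq_mul] at this
    rw [← this]
    refine Finset.sum_congr rfl fun σ _ => ?_
    simp [Equiv.Perm.permMatrix, PEquiv.toMatrix_apply, eq_comm]
  simp only [hik, Finset.sum_mul]
  rw [Finset.sum_comm]
  simp [Finset.sum_apply]

lemma exists_eigenframe {S : Mat n} (hS : S.IsSymm) :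
    ∃ Q : Mat n, Q * Qᵀ = 1 ∧ Q * S * Qᵀ = Matrix.diagonal (eigenVec S) := by
  have hH : S.IsHermitian := by
    rw [Matrix.IsHermitian, Matrix.conjTranspose_eq_transpose_of_trivial]; exact hS
  set V : Mat n := (hH.eigenvectorUnitary : Matrix (Fin n) (Fin n) ℝ) with hV
  have h1 : Vᵀ * V = 1 := by
    have := hH.eigenvectorUnitary.2
    rw [Matrix.mem_unitaryGroup_iff', Matrix.star_eq_conjTranspose,
      Matrix.conjTranspose_eq_transpose_of_trivial] at this
    exact this
  refine ⟨Vᵀ, by rw [Matrix.transpose_transpose]; exact h1, ?_⟩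
  have := hH.conjStarAlgAut_star_eigenvectorUnitary
  rw [Unitary.conjStarAlgAut_star_apply, Matrix.star_eq_conjTranspose,
    Matrix.conjTranspose_eq_transpose_of_trivial] at this
  rw [Matrix.transpose_transpose, eigenVec, dif_pos hH]
  simpa using this

/-- Diagonal of `S` in the frame given by the rows of `Q`. -/
def frameDiag (Q S : Mat n) : Fin n → ℝ := fun i => (Q * S * Qᵀ) i i

lemma frameDiag_eq_sum_perm {Q S : Mat n} (hQ : Q * Qᵀ = 1) (hS : S.IsSymm) :
    ∃ w : Equiv.Perm (Fin n) → ℝ, (∀ σ, 0 ≤ w σ) ∧ ∑ σ, w σ = 1 ∧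
      frameDiag Q S = ∑ σ, w σ • (eigenVec S ∘ σ) := by
  obtain ⟨V, hV, hVS⟩ := exists_eigenframe hS
  have hV' : Vᵀ * V = 1 := mul_eq_one_comm.1 hV
  have hO : (Q * Vᵀ) * (Q * Vᵀ)ᵀ = 1 := by
    rw [Matrix.transpose_mul, Matrix.transpose_transpose, Matrix.mul_assoc, ← Matrix.mul_assoc Vᵀ,
      hV', Matrix.one_mul, hQ]
  obtain ⟨w, hw0, hw1, hw⟩ := sum_perm_of_orthogonal hO
  refine ⟨w, hw0, hw1, ?_⟩
  rw [← hw]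
  funext i
  have hS2 : Q * S * Qᵀ = (Q * Vᵀ) * Matrix.diagonal (eigenVec S) * (Q * Vᵀ)ᵀ := by
    rw [← hVS, Matrix.transpose_mul, Matrix.transpose_transpose]
    calc Q * S * Qᵀ = Q * (Vᵀ * V) * S * (Vᵀ * V) * Qᵀ := by simp [hV']
      _ = _ := by simp only [Matrix.mul_assoc]
  simp only [frameDiag, hS2]
  rw [Matrix.mul_apply]
  refine Finset.sum_congr rfl fun k _ => ?_
  rw [Matrix.mul_diagonal, Matrix.transpose_apply]
  ring

variable {Γ : Set (Fin n → ℝ)} {f : (Fin n → ℝ) → ℝ}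

lemma frameDiag_mem (hΓ : GoodCone Γ) {Q S : Mat n} (hQ : Q * Qᵀ = 1) (hS : S.IsSymm)
    (h : eigenVec S ∈ Γ) : frameDiag Q S ∈ Γ := by
  obtain ⟨w, hw0, hw1, hw⟩ := frameDiag_eq_sum_perm hQ hS
  rw [hw]
  exact hΓ.2.1.sum_mem (fun σ _ => hw0 σ) hw1 fun σ _ => hΓ.2.2.2.1 σ _ h

lemma le_frameDiag (hΓ : GoodCone Γ) (hfs : SmoothSymF Γ f) (hf2 : F2cond Γ f) {Q S : Mat n}
    (hQ : Q * Qᵀ = 1) (hS : S.IsSymm) (h : eigenVec S ∈ Γ) :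
    f (eigenVec S) ≤ f (frameDiag Q S) := by
  obtain ⟨w, hw0, hw1, hw⟩ := frameDiag_eq_sum_perm hQ hS
  have := ConcaveOn.le_map_sum hf2 (t := Finset.univ) (w := w) (p := fun σ => eigenVec S ∘ σ)
    (fun σ _ => hw0 σ) hw1 fun σ _ => hΓ.2.2.2.1 σ _ h
  rw [hw]
  refine le_trans (le_of_eq ?_) this
  simp [hfs.2 _ _ h, ← Finset.sum_mul, hw1]

lemma fderiv_eq_sum_fLam (lam v : Fin n → ℝ) :
    fderiv ℝ f lam v = ∑ i, fLam f lam i * v i := by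
  conv_lhs => rw [pi_eq_sum_univ' v]
  rw [map_sum]
  refine Finset.sum_congr rfl fun i _ => ?_
  rw [map_smul, smul_eq_mul, mul_comm]
  congr 2

lemma le_linearization (hΓ : GoodCone Γ) (hfs : SmoothSymF Γ f) (hf2 : F2cond Γ f)
    {lam d : Fin n → ℝ} (hl : lam ∈ Γ) (hd : d ∈ Γ) :
    f d ≤ f lam + ∑ i, fLam f lam i * (d i - lam i) := by
  have hdiff : DifferentiableAt ℝ f lam :=
    (hfs.1.contDiffAt (hΓ.1.mem_nhds hl)).differentiableAt (by simp)
  have hφ : HasDerivAt (fun s : ℝ => f (lam + s • (d - lam))) (fderiv ℝ f lam (d - lam)) 0 := by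
    have h1 : HasDerivAt (fun s : ℝ => lam + s • (d - lam)) (d - lam) 0 := by
      simpa using ((hasDerivAt_id (0 : ℝ)).smul_const (d - lam)).const_add lam
    have h2 : HasFDerivAt f (fderiv ℝ f lam) (lam + (0 : ℝ) • (d - lam)) := by
      simpa using hdiff.hasFDerivAt
    exact h2.comp_hasDerivAt 0 h1
  have hs : f d - f lam ≤ fderiv ℝ f lam (d - lam) := by
    refine ge_of_tendsto hφ.tendsto_slope_zero_right ?_
    filter_upwards [Ioc_mem_nhdsGT (zero_lt_one' ℝ)] with s hs
    have h1 := hf2.2 hl hd (sub_nonneg.2 hs.2) hs.1.le (by ring)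
    have h2 : (1 - s) • lam + s • d = lam + s • (d - lam) := by module
    rw [h2] at h1
    simp only [zero_add, zero_smul, add_zero, smul_eq_mul] at h1 ⊢
    rw [le_inv_mul_iff₀ hs.1]
    linarith
  rw [fderiv_eq_sum_fLam] at hs
  simp only [Pi.sub_apply] at hs
  linarith

lemma sum_fLam_mul_nonneg (hΓ : GoodCone Γ) (hfs : SmoothSymF Γ f) (hf2 : F2cond Γ f)
    (hf5 : F5cond Γ f) {lam μ : Fin n → ℝ} (hl : lam ∈ Γ) (hμ : μ ∈ Γ) :
    0 ≤ ∑ i, fLam f lam i * μ i := by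
  by_contra! hneg
  set a := ∑ i, fLam f lam i * μ i
  set c := f lam - ∑ i, fLam f lam i * lam i with hc
  have key : ∀ s : ℝ, 0 < s → 0 < c + s * a := fun s hs => by
    have h1 := hf5.1 _ (hΓ.2.2.1 μ hμ s hs)
    have h2 := le_linearization hΓ hfs hf2 hl (hΓ.2.2.1 μ hμ s hs)
    have h3 : ∑ i, fLam f lam i * ((s • μ) i - lam i) = s * a - ∑ i, fLam f lam i * lam i := by
      rw [Finset.mul_sum, ← Finset.sum_sub_distrib]
      refine Finset.sum_congr rfl fun i _ => ?_
      simp only [Pi.smul_apply, smul_eq_mul]; ring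
    linarith
  have := key ((|c| + 1) / (-a)) (div_pos (by positivity) (by linarith))
  have h4 : (|c| + 1) / (-a) * a = -(|c| + 1) := by
    rw [div_mul_eq_mul_div, div_eq_iff (by linarith)]; ring
  rw [h4] at this
  linarith [le_abs_self c]

lemma sum_fLam_mul_self_le (hΓ : GoodCone Γ) (hfs : SmoothSymF Γ f) (hf2 : F2cond Γ f)
    (hf5 : F5cond Γ f) {lam : Fin n → ℝ} (hl : lam ∈ Γ) :
    ∑ i, fLam f lam i * lam i ≤ f lam := by
  set a := ∑ i, fLam f lam i * lam i with ha
  have key : ∀ s : ℝ, 0 < s → 0 < f lam + (s - 1) * a := fun s hs => by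
    have h1 := hf5.1 _ (hΓ.2.2.1 lam hl s hs)
    have h2 := le_linearization hΓ hfs hf2 hl (hΓ.2.2.1 lam hl s hs)
    have h3 : ∑ i, fLam f lam i * ((s • lam) i - lam i) = (s - 1) * a := by
      rw [Finset.mul_sum]
      refine Finset.sum_congr rfl fun i _ => ?_
      simp only [Pi.smul_apply, smul_eq_mul]; ring
    linarith
  have ht : Filter.Tendsto (fun s : ℝ => f lam + (s - 1) * a) (𝓝[>] 0)
      (𝓝 (f lam + (0 - 1) * a)) := by
    have : Continuous fun s : ℝ => f lam + (s - 1) * a := by fun_prop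
    exact (this.tendsto 0).mono_left nhdsWithin_le_nhds
  have := ge_of_tendsto ht (b := 0) (by
    filter_upwards [self_mem_nhdsWithin] with s hs
    exact (key s hs).le)
  linarith

lemma sum_pos_of_mem (hn : 0 < n) (hΓ : GoodCone Γ) {lam : Fin n → ℝ} (hl : lam ∈ Γ) :
    0 < ∑ i, lam i := by
  obtain ⟨hopen, hconv, hcone, hsymm, hpos, hne⟩ := hΓ
  by_contra! hle
  have : NeZero n := ⟨hn.ne'⟩
  have hnR : (0 : ℝ) < n := by exact_mod_cast hn
  have hadd : ∀ a ∈ Γ, ∀ b ∈ Γ, a + b ∈ Γ := fun a ha b hb => by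
    have h1 := hconv ha hb (a := 1 / 2) (b := 1 / 2) (by norm_num) (by norm_num) (by norm_num)
    have h2 := hcone _ h1 2 (by norm_num)
    convert h2 using 1
    module
  -- averaging over the cyclic shifts
  have hsum : ∀ s : Finset (Fin n), s.Nonempty →
      (∑ k ∈ s, lam ∘ (Equiv.addRight k)) ∈ Γ := by
    intro s hs
    induction hs using Finset.Nonempty.cons_induction with
    | singleton a => rw [Finset.sum_singleton]; exact hsymm _ _ hl
    | cons a s ha hs ih =>
      rw [Finset.sum_cons]
      exact hadd _ (hsymm _ _ hl) _ ih
  have hconst := hsum Finset.univ Finset.univ_nonempty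
  have hval : (∑ k, lam ∘ (Equiv.addRight k)) = fun _ : Fin n => ∑ i, lam i := by
    funext i
    simp only [Finset.sum_apply, Function.comp]
    exact Equiv.sum_comp (Equiv.addLeft i) lam
  rw [hval] at hconst
  have hzero : (0 : Fin n → ℝ) ∈ Γ := by
    rcases hle.lt_or_eq with h | h
    · have := hadd _ hconst _ (hpos (show (fun _ : Fin n => -∑ i, lam i) ∈ _ from
        fun i => by simpa using h))
      convert this using 1
      funext i; simp
    · rw [h] at hconst; exact hconst
  apply hne
  obtain ⟨ε, hε, hball⟩ := Metric.isOpen_iff.1 hopen 0 hzero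
  refine Set.eq_univ_of_forall fun v => ?_
  set s := ε / (2 * (‖v‖ + 1)) with hs
  have hs0 : 0 < s := by positivity
  have hv : s • v ∈ Γ := by
    apply hball
    rw [mem_ball_zero_iff, norm_smul, Real.norm_of_nonneg hs0.le, hs, div_mul_eq_mul_div,
      div_lt_iff₀ (by positivity)]
    nlinarith [norm_nonneg v]
  have := hcone _ hv s⁻¹ (by positivity)
  rwa [smul_smul, inv_mul_cancel₀ hs0.ne', one_smul] at this

end Cone

/-! ### Rotating frames -/

section Rotation

variable {n : ℕ}

open scoped Matrix.Norms.Operator in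
lemma exists_rotation {B : Mat n} (hB : Bᵀ = -B) :
    ∃ R : ℝ → Mat n, (∀ s, R s * (R s)ᵀ = 1) ∧
      ∀ i j, HasJet (fun s => R s i j) ((1 : Mat n) i j) (B i j) ((B * B) i j) := by
  refine ⟨fun s => NormedSpace.exp (s • B), fun s => ?_, fun i j => ?_⟩
  · rw [← Matrix.exp_transpose, Matrix.transpose_smul, hB, smul_neg,
      ← Matrix.exp_add_of_commute _ _ (Commute.refl (s • B)).neg_right, add_neg_cancel,
      NormedSpace.exp_zero]
  · have hentry : ∀ (φ : ℝ → Mat n) (φ' : Mat n) (s : ℝ), HasDerivAt φ φ' s →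
        HasDerivAt (fun r => φ r i j) (φ' i j) s := fun φ φ' s h =>
      (LinearMap.toContinuousLinearMap (Matrix.entryLinearMap ℝ ℝ i j)).hasFDerivAt.comp_hasDerivAt
        s h
    refine ⟨fun s => (NormedSpace.exp (s • B) * B) i j,
      fun s => hentry _ _ _ (hasDerivAt_exp_smul_const B s), by simp, by simp, ?_⟩
    have h := (hasDerivAt_exp_smul_const B (0 : ℝ)).mul_const B
    have := hentry _ _ _ h
    rw [zero_smul, NormedSpace.exp_zero, Matrix.one_mul] at this
    exact this

end Rotation

/-! ### The final algebraic inequality -/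

lemma gradient_term_bound_of_lt {c L F F0 l η V d : ℝ} (hF : 0 < F) (hF0 : 0 < F0)
    (hL : 0 < L) (hV : V + d = -(L * η)) (hd : |d| ≤ c * L) (hFF : F0 < F)
    (hlL : -(L / 2) ≤ l) :
    ∃ b : ℝ, L * (F * η ^ 2 - 7 * c ^ 2 * F - 8 / 3 * (F0 * η ^ 2)) ≤
      -(4 * ((F - F0) * (b * V)) + 2 * (b ^ 2 * ((F - F0) * (L - l)))) := by
  obtain ⟨v, rfl⟩ : ∃ v, V = L * v := ⟨V / L, by field_simp⟩
  obtain ⟨e, rfl⟩ : ∃ e, d = L * e := ⟨d / L, by field_simp⟩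
  have hev : η = -(v + e) := by
    have : L * (v + e + η) = 0 := by linarith
    rcases mul_eq_zero.1 this with h | h <;> linarith
  have hec : e ^ 2 ≤ c ^ 2 := by
    have : |e| ≤ c := by
      rw [abs_mul, abs_of_pos hL, mul_comm] at hd
      exact le_of_mul_le_mul_right hd hL
    rw [← sq_abs e]; exact pow_le_pow_left₀ (abs_nonneg _) this 2
  refine ⟨-(2 / 3) * v, ?_⟩
  have hX : 0 ≤ (F - F0) * v ^ 2 := mul_nonneg (by linarith) (sq_nonneg _)
  have hXl : 0 ≤ (F - F0) * v ^ 2 * (L / 2 + l) := mul_nonneg hX (by linarith)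
  have hg : -(4 * ((F - F0) * (-(2 / 3) * v * (L * v))) +
        2 * ((-(2 / 3) * v) ^ 2 * ((F - F0) * (L - l)))) =
      L * (4 / 3 * ((F - F0) * v ^ 2)) + 8 / 9 * ((F - F0) * v ^ 2 * (L / 2 + l)) := by ring
  have h1 : η ^ 2 ≤ 4 / 3 * v ^ 2 + 4 * c ^ 2 := by
    rw [hev]; nlinarith [sq_nonneg (v - 3 * e)]
  have h2 : v ^ 2 ≤ 2 * η ^ 2 + 2 * c ^ 2 := by
    rw [hev]; nlinarith [sq_nonneg (v + 2 * e)]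
  have h3 := mul_le_mul_of_nonneg_left h1 hF.le
  have h4 := mul_le_mul_of_nonneg_left h2 hF0.le
  have h5 : F0 * c ^ 2 ≤ F * c ^ 2 := by gcongr
  have h6 : 0 ≤ F * c ^ 2 := by positivity
  have h7 : F * η ^ 2 - 7 * c ^ 2 * F - 8 / 3 * (F0 * η ^ 2) ≤ 4 / 3 * ((F - F0) * v ^ 2) := by
    linarith
  have h8 := mul_le_mul_of_nonneg_left h7 hL.le
  rw [hg]
  linarith

lemma gradient_term_bound {n : ℕ} {c δ N L T2 F F0 l η V d : ℝ} (hc : 1 ≤ c)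
    (hδ1 : δ ≤ 1) (hN : 0 ≤ N) (hF : 0 < F) (hF0 : 0 < F0) (hδ : 0 < δ)
    (hL : 1 ≤ L) (hLN : 1 + N ≤ δ * L) (hl : |l| ≤ n * L) (hη : |η| ≤ c * (δ * (|l| + 1) + N))
    (hV : V + d = -(L * η)) (hd : |d| ≤ c * L) (hT : F * l ^ 2 ≤ T2) (hT0 : F0 * L ^ 2 ≤ T2) :
    ∃ b : ℝ, (F = F0 → b = 0) ∧
      L * (F * η ^ 2 - 7 * c ^ 2 * F - (8 * c ^ 2 * (n ^ 2 + 1) + 15 * c ^ 2) * (δ ^ 2 * T2)) ≤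
        -(4 * ((F - F0) * (b * V)) + 2 * (b ^ 2 * ((F - F0) * (L - l)))) := by
  have hT2 : 0 ≤ T2 := le_trans (by positivity) hT
  have hL0 : 0 < L := by linarith
  have hη2 : η ^ 2 ≤ 3 * c ^ 2 * (δ ^ 2 * l ^ 2 + (1 + N ^ 2)) := by
    have h1 : η ^ 2 ≤ (c * (δ * (|l| + 1) + N)) ^ 2 := by
      rw [← sq_abs η]; exact pow_le_pow_left₀ (abs_nonneg _) hη 2
    have h2 : (δ * (|l| + 1) + N) ^ 2 ≤ 3 * (δ ^ 2 * l ^ 2 + (1 + N ^ 2)) := by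
      have e : δ ^ 2 ≤ 1 := by nlinarith
      rw [← sq_abs l]
      nlinarith [sq_nonneg (δ * |l| - δ), sq_nonneg (δ * |l| - N), sq_nonneg (δ - N)]
    calc η ^ 2 ≤ _ := h1
      _ = c ^ 2 * (δ * (|l| + 1) + N) ^ 2 := by ring
      _ ≤ c ^ 2 * (3 * (δ ^ 2 * l ^ 2 + (1 + N ^ 2))) := by gcongr
      _ = _ := by ring
  have hNL : 1 + N ^ 2 ≤ δ ^ 2 * L ^ 2 := by
    have := pow_le_pow_left₀ (by linarith) hLN 2
    nlinarith
  have hl2 : l ^ 2 ≤ n ^ 2 * L ^ 2 := by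
    have := pow_le_pow_left₀ (abs_nonneg l) hl 2
    rw [sq_abs] at this; linarith
  set D := 3 * c ^ 2 * (n ^ 2 + 1) * (δ ^ 2 * T2) with hD
  have hF0η : F0 * η ^ 2 ≤ D := by
    calc F0 * η ^ 2 ≤ F0 * (3 * c ^ 2 * (δ ^ 2 * (n ^ 2 * L ^ 2) + δ ^ 2 * L ^ 2)) := by
          gcongr
          refine hη2.trans ?_
          gcongr
      _ = 3 * c ^ 2 * (n ^ 2 + 1) * (δ ^ 2 * (F0 * L ^ 2)) := by ring
      _ ≤ D := by rw [hD]; gcongr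
  have hDB : (8 * c ^ 2 * (n ^ 2 + 1) + 15 * c ^ 2) * (δ ^ 2 * T2) =
      8 / 3 * D + 15 * c ^ 2 * (δ ^ 2 * T2) := by rw [hD]; ring
  have hpos : 0 ≤ 15 * c ^ 2 * (δ ^ 2 * T2) := by positivity
  have hcF : 0 ≤ 7 * c ^ 2 * F := by positivity
  have hD0 : 0 ≤ D := by positivity
  by_cases hcase : F0 < F ∧ -(L / 2) ≤ l
  · obtain ⟨hFF, hlL⟩ := hcase
    obtain ⟨b, hb⟩ := gradient_term_bound_of_lt hF hF0 hL0 hV hd hFF hlL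
    refine ⟨b, fun h => absurd h hFF.ne', le_trans ?_ hb⟩
    refine mul_le_mul_of_nonneg_left ?_ hL0.le
    rw [hDB]
    linarith
  · refine ⟨0, fun _ => rfl, ?_⟩
    have : F * η ^ 2 ≤ (8 * c ^ 2 * (n ^ 2 + 1) + 15 * c ^ 2) * (δ ^ 2 * T2) := by
      rw [hDB]
      by_cases hFF : F0 < F
      · have hlL : l < -(L / 2) := by
          by_contra! h
          exact hcase ⟨hFF, h⟩
        have h4 : L ^ 2 ≤ 4 * l ^ 2 := by nlinarith
        calc F * η ^ 2 ≤ F * (3 * c ^ 2 * (δ ^ 2 * l ^ 2 + δ ^ 2 * (4 * l ^ 2))) := by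
              gcongr
              refine hη2.trans ?_
              gcongr
              exact hNL.trans (by gcongr)
          _ = 15 * c ^ 2 * (δ ^ 2 * (F * l ^ 2)) := by ring
          _ ≤ 15 * c ^ 2 * (δ ^ 2 * T2) := by gcongr
          _ ≤ _ := by linarith
      · have : F * η ^ 2 ≤ F0 * η ^ 2 := by gcongr; linarith
        linarith
    nlinarith

lemma exists_final_constants (n : ℕ) {c θ : ℝ} (hc : 1 ≤ c) (hθ : 0 < θ) :
    ∃ δ N M Λ : ℝ, 0 < δ ∧ δ ≤ 1 ∧ 0 ≤ N ∧ 0 ≤ M ∧ 1 ≤ Λ ∧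
      ∀ (i₀ : Fin n) (F lam η V d : Fin n → ℝ), (∀ i, 0 < F i) →
        (∀ i, |lam i| ≤ n * lam i₀) → (∀ i, |η i| ≤ c * (δ * (|lam i| + 1) + N)) →
        (∀ k, V k + d k = -(lam i₀ * η k)) → (∀ k, |d k| ≤ c * lam i₀) →
        (∀ b : Fin n → ℝ, b i₀ = 0 →
          lam i₀ * (δ / 2 * (∑ i, F i * lam i ^ 2) + N * θ * (∑ i, F i) - c * (1 + ∑ i, F i)
              - c * N + M - ∑ i, F i * η i ^ 2)
            - c * (1 + ∑ i, F i) * lam i₀ - c * (∑ i, F i * lam i ^ 2)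
            - ∑ k, (4 * ((F k - F i₀) * (b k * V k)) +
                2 * (b k ^ 2 * ((F k - F i₀) * (lam i₀ - lam k)))) ≤ 0) →
        lam i₀ ≤ Λ := by
  set B := 8 * c ^ 2 * ((n : ℝ) ^ 2 + 1) + 15 * c ^ 2 with hB
  have hB0 : 0 < B := by positivity
  set δ := 1 / (4 * n * B + 1) with hδ
  have hδ0 : 0 < δ := by positivity
  have hδ1 : δ ≤ 1 := by
    rw [hδ, div_le_one (by positivity)]
    have : 0 ≤ 4 * n * B := by positivity
    linarith
  have hδB : n * (B * δ ^ 2) ≤ δ / 4 := by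
    have h : δ * (4 * n * B + 1) = 1 := by rw [hδ]; field_simp
    have h' : n * B * δ ≤ 1 / 4 := by linarith
    nlinarith
  set N := (2 * c + 7 * c ^ 2) / θ with hN
  have hN0 : 0 ≤ N := by positivity
  have hNθ : N * θ = 2 * c + 7 * c ^ 2 := by rw [hN]; field_simp
  set M := 2 * c + c * N + 1 with hM
  have hM0 : 0 ≤ M := by positivity
  refine ⟨δ, N, M, 1 + (1 + N) / δ + 4 * c / δ, hδ0, hδ1, hN0, hM0, ?_, ?_⟩
  · have h1 : 0 ≤ (1 + N) / δ := by positivity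
    have h2 : 0 ≤ 4 * c / δ := by positivity
    linarith
  intro i₀ F lam η V d hF hlam hη hV hd hb
  by_contra! hΛ
  set L := lam i₀ with hL
  have hp1 : 0 ≤ (1 + N) / δ := by positivity
  have hp2 : 0 ≤ 4 * c / δ := by positivity
  have hL1 : 1 ≤ L := by linarith
  have hLN : 1 + N ≤ δ * L := by
    have : (1 + N) / δ ≤ L := by linarith
    rw [div_le_iff₀ hδ0] at this; linarith
  have hLc : 4 * c ≤ δ * L := by
    have : 4 * c / δ ≤ L := by linarith
    rw [div_le_iff₀ hδ0] at this; linarith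
  set T2 := ∑ i, F i * lam i ^ 2 with hT2
  set S := ∑ i, F i with hS
  have hS0 : 0 ≤ S := Finset.sum_nonneg fun i _ => (hF i).le
  have hT20 : 0 ≤ T2 := Finset.sum_nonneg fun i _ => mul_nonneg (hF i).le (sq_nonneg _)
  have hTi : ∀ i, F i * lam i ^ 2 ≤ T2 := fun i =>
    Finset.single_le_sum (f := fun i => F i * lam i ^ 2)
      (fun j _ => mul_nonneg (hF j).le (sq_nonneg _)) (Finset.mem_univ i)
  choose b hb0 hbk using fun k => gradient_term_bound (n := n) hc hδ1 hN0 (hF k) (hF i₀) hδ0 hL1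
    hLN (hlam k) (hη k) (hV k) (hd k) (hTi k) (hTi i₀)
  have hsum := Finset.sum_le_sum fun k (_ : k ∈ Finset.univ) => hbk k
  rw [← Finset.mul_sum, Finset.sum_sub_distrib, Finset.sum_sub_distrib, ← Finset.mul_sum,
    Finset.sum_const, Finset.card_univ, Fintype.card_fin, nsmul_eq_mul,
    Finset.sum_neg_distrib, ← hS, ← hB] at hsum
  have h := hb b (hb0 i₀ rfl)
  have hkey : L * (δ / 2 * T2 + N * θ * S - c * (1 + S) - c * N + M - 7 * c ^ 2 * S
      - n * (B * (δ ^ 2 * T2)) - c * (1 + S)) - c * T2 ≤ 0 := by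
    linarith
  have hn1 : n * (B * (δ ^ 2 * T2)) ≤ δ / 4 * T2 := by
    calc n * (B * (δ ^ 2 * T2)) = n * (B * δ ^ 2) * T2 := by ring
      _ ≤ _ := by gcongr
  rw [hNθ] at hkey
  have hin : δ / 4 * T2 + 1 ≤ δ / 2 * T2 + (2 * c + 7 * c ^ 2) * S - c * (1 + S) - c * N + M
      - 7 * c ^ 2 * S - n * (B * (δ ^ 2 * T2)) - c * (1 + S) := by
    rw [hM]; nlinarith
  have h3 := mul_le_mul_of_nonneg_left hin (by linarith : 0 ≤ L)
  have h4 : c * T2 ≤ δ * L / 4 * T2 := by gcongr; linarith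
  nlinarith

/-! ### Second-order consequences of the equation -/

section Touching

variable {n : ℕ}

lemma HasJet.rotate {R U : ℝ → Mat n} {B V W : Mat n} {lam : Fin n → ℝ} (hB : Bᵀ = -B)
    (hV : Vᵀ = V)
    (hR : ∀ i j, HasJet (fun s => R s i j) ((1 : Mat n) i j) (B i j) ((B * B) i j))
    (hU : ∀ i j, HasJet (fun s => U s i j) (Matrix.diagonal lam i j) (V i j) (W i j)) (i : Fin n) :
    HasJet (fun s => (R s * U s * (R s)ᵀ) i i) (lam i) (V i i)
      (W i i + 4 * (∑ j, B i j * V i j) + 2 * ∑ j, B i j ^ 2 * (lam j - lam i)) := by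
  have h := HasJet.sum (s := Finset.univ) fun j _ =>
    (HasJet.sum (s := Finset.univ) fun k _ => (hR i k).mul (hU k j)).mul (hR i j)
  have hfun : (fun s => (R s * U s * (R s)ᵀ) i i) =
      fun s => ∑ j, (∑ k, R s i k * U s k j) * R s i j := by
    funext s
    simp [Matrix.mul_apply]
  have hskew : ∀ a b, B a b = -B b a := fun a b => by
    have := congrFun (congrFun hB b) a
    simpa using this
  have hsymm : ∀ a b, V a b = V b a := fun a b => congrFun (congrFun hV b) a
  have hBii : B i i = 0 := by linarith [hskew i i]
  have hBB : (B * B) i i = -∑ j, B i j ^ 2 := by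
    rw [Matrix.mul_apply, ← Finset.sum_neg_distrib]
    exact Finset.sum_congr rfl fun j _ => by rw [hskew j i]; ring
  rw [hfun]
  convert h using 1
  · simp [Matrix.one_apply, Matrix.diagonal_apply]
  · simp [Matrix.one_apply, Matrix.diagonal_apply, Finset.sum_add_distrib, hBii]
  · have e1 : ∀ j, ∑ k, ((1 : Mat n) i k * Matrix.diagonal lam k j) = Matrix.diagonal lam i j :=
      fun j => by simp [Matrix.one_apply]
    have e2 : ∀ j, ∑ k, (B i k * Matrix.diagonal lam k j + (1 : Mat n) i k * V k j) =
        B i j * lam j + V i j := fun j => by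
      simp [Matrix.one_apply, Matrix.diagonal_apply, Finset.sum_add_distrib]
    have e3 : ∀ j, ∑ k, ((B * B) i k * Matrix.diagonal lam k j + 2 * (B i k * V k j) +
        (1 : Mat n) i k * W k j) =
        (B * B) i j * lam j + 2 * ∑ k, B i k * V k j + W i j := fun j => by
      simp [Matrix.one_apply, Matrix.diagonal_apply, Finset.sum_add_distrib, Finset.mul_sum]
    simp only [e1, e2, e3]
    simp only [Finset.sum_add_distrib, Matrix.one_apply, Matrix.diagonal_apply, mul_ite, ite_mul,
      mul_one, mul_zero, zero_mul, Finset.sum_ite_eq, Finset.mem_univ, if_true]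
    rw [hBB]
    have e4 : ∑ x, 2 * ((B i x * lam x + V i x) * B i x) =
        2 * ∑ x, B i x ^ 2 * lam x + 2 * ∑ x, B i x * V i x := by
      rw [Finset.mul_sum, Finset.mul_sum, ← Finset.sum_add_distrib]
      exact Finset.sum_congr rfl fun x _ => by ring
    have e5 : ∑ j, B i j ^ 2 * (lam j - lam i) =
        ∑ j, B i j ^ 2 * lam j - (∑ j, B i j ^ 2) * lam i := by
      rw [Finset.sum_mul, ← Finset.sum_sub_distrib]
      exact Finset.sum_congr rfl fun x _ => by ring
    have e6 : ∑ k, B i k * V k i = ∑ k, B i k * V i k :=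
      Finset.sum_congr rfl fun x _ => by rw [hsymm x i]
    rw [e4, e5, e6]
    ring

variable {Γ : Set (Fin n → ℝ)} {f : (Fin n → ℝ) → ℝ}

/-- First- and second-order conditions along a curve of symmetric matrices on which
`f` of the eigenvalues is prescribed, tested against a rotating frame. -/
lemma curve_conditions (hΓ : GoodCone Γ) (hfs : SmoothSymF Γ f) (hf2 : F2cond Γ f)
    {S : ℝ → Mat n} {r : ℝ → ℝ} {Q V W : Mat n} {lam b : Fin n → ℝ} {r0 r1 r2 : ℝ} {i₀ : Fin n}
    (hQ : Q * Qᵀ = 1) (hlam : lam ∈ Γ)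
    (hS : ∀ᶠ s in 𝓝 0, (S s).IsSymm ∧ eigenVec (S s) ∈ Γ ∧ f (eigenVec (S s)) = r s)
    (hr : HasJet r r0 r1 r2) (hr0 : f lam = r0) (hV : Vᵀ = V)
    (hU : ∀ i j, HasJet (fun s => (Q * S s * Qᵀ) i j) (Matrix.diagonal lam i j) (V i j) (W i j))
    (hb : b i₀ = 0) :
    ∑ i, fLam f lam i * V i i = r1 ∧
      r2 ≤ ∑ i, fLam f lam i * W i i +
        ∑ k, (4 * ((fLam f lam k - fLam f lam i₀) * (b k * V i₀ k)) +
          2 * (b k ^ 2 * ((fLam f lam k - fLam f lam i₀) * (lam i₀ - lam k)))) := by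
  set B : Mat n := Matrix.of fun i j => (if j = i₀ then b i else 0) - (if i = i₀ then b j else 0)
    with hBdef
  have hB : Bᵀ = -B := by
    ext i j; simp [hBdef]
  obtain ⟨R, hR, hRj⟩ := exists_rotation hB
  have hrot := HasJet.rotate hB hV hRj hU
  have hjet := (HasJet.const (f lam)).add ((HasJet.sum (s := Finset.univ) fun i _ =>
    ((hrot i).sub (HasJet.const (lam i))).const_mul (fLam f lam i))) |>.sub hr
  have hmin : IsLocalMin (fun s => f lam + ∑ i, fLam f lam i *
      ((R s * (Q * S s * Qᵀ) * (R s)ᵀ) i i - lam i) - r s) 0 := by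
    have h0 : f lam + ∑ i, fLam f lam i *
      ((R 0 * (Q * S 0 * Qᵀ) * (R 0)ᵀ) i i - lam i) - r 0 = 0 := by
      obtain ⟨_, _, h, _⟩ := hjet
      exact h.trans (by simp [hr0])
    filter_upwards [hS] with s hs
    rw [h0]
    obtain ⟨h1, h2, h3⟩ := hs
    have hRQ : (R s * Q) * (R s * Q)ᵀ = 1 := by
      rw [Matrix.transpose_mul, Matrix.mul_assoc, ← Matrix.mul_assoc Q, hQ, Matrix.one_mul, hR]
    have h4 := le_frameDiag hΓ hfs hf2 hRQ h1 h2
    have h5 := le_linearization hΓ hfs hf2 hlam (frameDiag_mem hΓ hRQ h1 h2)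
    have h6 : ∀ i, frameDiag (R s * Q) (S s) i = (R s * (Q * S s * Qᵀ) * (R s)ᵀ) i i := fun i => by
      simp only [frameDiag, Matrix.transpose_mul, Matrix.mul_assoc]
    simp only [h6] at h5
    linarith
  obtain ⟨h1, h2⟩ := hjet.eq_zero_and_nonneg_of_isLocalMin hmin
  simp only [sub_zero, zero_add] at h1 h2
  refine ⟨by linarith, ?_⟩
  have hquad : ∑ i, fLam f lam i * (W i i + 4 * (∑ j, B i j * V i j) +
        2 * ∑ j, B i j ^ 2 * (lam j - lam i)) =
      ∑ i, fLam f lam i * W i i +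
        ∑ k, (4 * ((fLam f lam k - fLam f lam i₀) * (b k * V i₀ k)) +
          2 * (b k ^ 2 * ((fLam f lam k - fLam f lam i₀) * (lam i₀ - lam k)))) := by
    have hsymm : ∀ a b, V a b = V b a := fun a b => congrFun (congrFun hV b) a
    have e1 : ∀ i, ∑ j, B i j * V i j = b i * V i i₀ - if i = i₀ then ∑ j, b j * V i j else 0 :=
      fun i => by
      simp only [hBdef, Matrix.of_apply, sub_mul, Finset.sum_sub_distrib, ite_mul, zero_mul,
        Finset.sum_ite_eq', Finset.mem_univ, if_true]
      split_ifs <;> simp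
    have e2 : ∀ i, ∑ j, B i j ^ 2 * (lam j - lam i) = b i ^ 2 * (lam i₀ - lam i) +
        if i = i₀ then ∑ j, b j ^ 2 * (lam j - lam i) else 0 := fun i => by
      by_cases hi : i = i₀
      · subst hi
        simp only [hBdef, Matrix.of_apply, if_true, hb, sub_self, mul_zero, zero_add]
        refine Finset.sum_congr rfl fun j _ => ?_
        split_ifs with hj
        · subst hj; simp
        · ring
      · simp [hBdef, hi, Finset.sum_ite_eq']
    simp only [e1, e2]
    simp only [mul_add, mul_sub, Finset.sum_add_distrib, mul_ite, mul_zero,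
      Finset.sum_sub_distrib, Finset.sum_ite_eq', Finset.mem_univ, if_true, Finset.mul_sum]
    rw [add_assoc]
    congr 1
    simp only [← Finset.sum_sub_distrib, ← Finset.sum_add_distrib]
    refine Finset.sum_congr rfl fun k _ => ?_
    rw [hsymm k i₀]
    ring
  rw [← hquad]
  linarith

end Touching

/-! ### Spatial gradients and the augmented Hessian in a frame -/

section Frame

variable {n : ℕ}

lemma contDiff_two_of_nat {X : Type*} [NormedAddCommGroup X] [NormedSpace ℝ X] {g : X → ℝ} {k : ℕ}
    (hk : 2 ≤ k) (hg : ContDiff ℝ (k : ℕ∞) g) : ContDiff ℝ 2 g := by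
  have : ContDiff ℝ ((2 : ℕ) : ℕ∞) g := hg.of_le (by exact_mod_cast hk)
  exact_mod_cast this

/-- A spatial vector, viewed as a vector of space-time. -/
def spat (ξ : Fin n → ℝ) : (Fin n → ℝ) × ℝ := (ξ, 0)

/-- The unit time vector. -/
def timeVec : (Fin n → ℝ) × ℝ := (0, 1)

/-- Spatial gradient of a function on space-time. -/
def xgrad (g : (Fin n → ℝ) × ℝ → ℝ) (q : (Fin n → ℝ) × ℝ) : Fin n → ℝ :=
  fun l => dd (spat (Pi.single l 1)) g q

/-- The entries of `A` in the frame `Q`. -/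
def frameEntry (A : (Fin n → ℝ) → ℝ → (Fin n → ℝ) → Mat n) (Q : Mat n) (j k : Fin n) :
    ((Fin n → ℝ) × ℝ) × (Fin n → ℝ) → ℝ :=
  fun y => (Q * A y.1.1 y.1.2 y.2 * Qᵀ) j k

lemma dd_spat (g : (Fin n → ℝ) × ℝ → ℝ) (ξ : Fin n → ℝ) (q : (Fin n → ℝ) × ℝ) :
    dd (spat ξ) g q = ∑ l, ξ l * xgrad g q l := by
  have h : spat ξ = ∑ l, ξ l • spat (Pi.single l (1 : ℝ)) := by
    refine Prod.ext ?_ ?_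
    · rw [Prod.fst_sum]
      simpa [spat] using pi_eq_sum_univ' ξ
    · rw [Prod.snd_sum]
      simp [spat]
  simp only [dd, xgrad]
  conv_lhs => rw [h]
  rw [map_sum]
  simp

lemma fderiv_slice {u : (Fin n → ℝ) × ℝ → ℝ} (x ξ : Fin n → ℝ) (t : ℝ)
    (hu : DifferentiableAt ℝ u (x, t)) :
    fderiv ℝ (fun y => u (y, t)) x ξ = dd (spat ξ) u (x, t) := by
  have h : HasFDerivAt (fun y => u (y, t))
      ((fderiv ℝ u (x, t)).comp (ContinuousLinearMap.inl ℝ (Fin n → ℝ) ℝ)) x :=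
    hu.hasFDerivAt.comp x (hasFDerivAt_prodMk_left x t)
  simp [dd, spat, h.fderiv]

lemma sgrad_eq_xgrad {u : (Fin n → ℝ) → ℝ → ℝ} (x : Fin n → ℝ) (t : ℝ)
    (hu : DifferentiableAt ℝ (fun q : (Fin n → ℝ) × ℝ => u q.1 q.2) (x, t)) :
    sgrad (fun y => u y t) x = xgrad (fun q => u q.1 q.2) (x, t) :=
  funext fun _ => fderiv_slice (u := fun q => u q.1 q.2) x _ t hu

lemma deriv_time {u : (Fin n → ℝ) → ℝ → ℝ} (x : Fin n → ℝ) (t : ℝ)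
    (hu : DifferentiableAt ℝ (fun q : (Fin n → ℝ) × ℝ => u q.1 q.2) (x, t)) :
    deriv (u x) t = dd timeVec (fun q => u q.1 q.2) (x, t) := by
  have h : HasDerivAt (u x)
      (fderiv ℝ (fun q : (Fin n → ℝ) × ℝ => u q.1 q.2) (x, t) (0, 1)) t :=
    hu.hasFDerivAt.comp_hasDerivAt t ((hasDerivAt_const t x).prodMk (hasDerivAt_id t))
  exact h.deriv

lemma shess_eq {u : (Fin n → ℝ) → ℝ → ℝ} (x : Fin n → ℝ) (t : ℝ)
    (hu : ContDiff ℝ 2 fun q : (Fin n → ℝ) × ℝ => u q.1 q.2) (i j : Fin n) :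
    shess (fun y => u y t) x i j =
      dd (spat (Pi.single i 1)) (dd (spat (Pi.single j 1)) fun q => u q.1 q.2) (x, t) := by
  have hd : Differentiable ℝ fun q : (Fin n → ℝ) × ℝ => u q.1 q.2 :=
    hu.differentiable (by norm_num)
  have h1 : (fun y => fderiv ℝ (fun y => u y t) y (Pi.single j 1)) =
      fun y => dd (spat (Pi.single j 1)) (fun q => u q.1 q.2) (y, t) := by
    funext y
    exact fderiv_slice (u := fun q => u q.1 q.2) y _ t (hd _)
  have h2 : ContDiff ℝ ((1 : ℕ) : ℕ∞)
      (dd (spat (Pi.single j (1 : ℝ))) fun q : (Fin n → ℝ) × ℝ => u q.1 q.2) :=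
    dd_contDiff (by exact_mod_cast hu) _
  rw [shess, Matrix.of_apply, h1]
  exact fderiv_slice x _ t (h2.differentiable (by norm_num) _)

lemma dd_spat_spat {g : (Fin n → ℝ) × ℝ → ℝ} (hg : ContDiff ℝ 2 g) (ξ ζ : Fin n → ℝ)
    (q : (Fin n → ℝ) × ℝ) :
    dd (spat ξ) (dd (spat ζ) g) q = ∑ l, ∑ m, ξ l *
      dd (spat (Pi.single l 1)) (dd (spat (Pi.single m 1)) g) q * ζ m := by
  rw [dd_spat]
  refine Finset.sum_congr rfl fun l _ => ?_
  simp only [xgrad]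
  rw [dd_comm hg, dd_spat, Finset.mul_sum]
  refine Finset.sum_congr rfl fun m _ => ?_
  simp only [xgrad]
  rw [dd_comm hg]
  ring

lemma frame_apply (Q S : Mat n) (j k : Fin n) :
    (Q * S * Qᵀ) j k = ∑ l, ∑ m, Q j l * S l m * Q k m := by
  simp only [Matrix.mul_apply, Matrix.transpose_apply, Finset.sum_mul]
  exact Finset.sum_comm

lemma frame_Umat {A : (Fin n → ℝ) → ℝ → (Fin n → ℝ) → Mat n} {u : (Fin n → ℝ) → ℝ → ℝ}
    (hu : ContDiff ℝ 2 fun q : (Fin n → ℝ) × ℝ => u q.1 q.2) (Q : Mat n)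
    (q : (Fin n → ℝ) × ℝ) (j k : Fin n) :
    (Q * Umat A u q.1 q.2 * Qᵀ) j k =
      dd (spat (Q j)) (dd (spat (Q k)) fun q => u q.1 q.2) q +
        frameEntry A Q j k (q, xgrad (fun q => u q.1 q.2) q) := by
  have hd : Differentiable ℝ fun q : (Fin n → ℝ) × ℝ => u q.1 q.2 :=
    hu.differentiable (by norm_num)
  rw [Umat, Matrix.mul_add, Matrix.add_mul, Matrix.add_apply, frame_apply, dd_spat_spat hu,
    sgrad_eq_xgrad _ _ (hd _)]
  simp only [shess_eq _ _ hu, frameEntry]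

lemma Umat_isSymm {A : (Fin n → ℝ) → ℝ → (Fin n → ℝ) → Mat n} (hA : ASmooth A)
    {u : (Fin n → ℝ) → ℝ → ℝ} (hu : ContDiff ℝ 2 fun q : (Fin n → ℝ) × ℝ => u q.1 q.2)
    (x : Fin n → ℝ) (t : ℝ) : (Umat A u x t).IsSymm := by
  refine Matrix.IsSymm.add (Matrix.IsSymm.ext fun i j => ?_) (hA.1 _ _ _)
  rw [shess_eq _ _ hu, shess_eq _ _ hu, dd_comm hu]

lemma frameEntry_contDiff {A : (Fin n → ℝ) → ℝ → (Fin n → ℝ) → Mat n} (hA : ASmooth A)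
    (Q : Mat n) (j k : Fin n) : ContDiff ℝ 2 (frameEntry A Q j k) := by
  unfold frameEntry
  simp only [frame_apply]
  refine ContDiff.sum fun l _ => ContDiff.sum fun m _ => ?_
  exact (contDiff_const.mul (contDiff_infty.1 (hA.2 l m) 2)).mul contDiff_const

lemma frameEntry_symm {A : (Fin n → ℝ) → ℝ → (Fin n → ℝ) → Mat n} (hA : ASmooth A)
    (Q : Mat n) (j k : Fin n) : frameEntry A Q j k = frameEntry A Q k j := by
  funext y
  have h : (Q * A y.1.1 y.1.2 y.2 * Qᵀ)ᵀ = Q * A y.1.1 y.1.2 y.2 * Qᵀ := by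
    rw [Matrix.transpose_mul, Matrix.transpose_mul, Matrix.transpose_transpose, hA.1,
      Matrix.mul_assoc]
  exact congrFun (congrFun h k) j

lemma hasJet_xgrad {g : (Fin n → ℝ) × ℝ → ℝ} (hg : ContDiff ℝ ((3 : ℕ) : ℕ∞) g)
    (q v : (Fin n → ℝ) × ℝ) :
    HasJet (fun s : ℝ => xgrad g (q + s • v)) (xgrad g q) (xgrad (dd v g) q)
      (xgrad (dd v (dd v g)) q) := by
  refine HasJet.pi fun l => ?_
  have h := hasJet_along (g := dd (spat (Pi.single l 1)) g)
    (by exact_mod_cast dd_contDiff (k := 2) hg _) q v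
  have h2 : ContDiff ℝ 2 g := contDiff_two_of_nat (by norm_num) hg
  have h3 : ContDiff ℝ 2 (dd v g) := by exact_mod_cast dd_contDiff (k := 2) hg v
  simp only [xgrad]
  rwa [dd_comm h3, dd_comm h2]

lemma hasJet_frame {A : (Fin n → ℝ) → ℝ → (Fin n → ℝ) → Mat n} (hA : ASmooth A)
    {u : (Fin n → ℝ) → ℝ → ℝ} {g : (Fin n → ℝ) × ℝ → ℝ} (hgu : g = fun q => u q.1 q.2)
    (hg : ContDiff ℝ ((4 : ℕ) : ℕ∞) g) (Q : Mat n) (q v : (Fin n → ℝ) × ℝ) (j k : Fin n) :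
    HasJet (fun s : ℝ => (Q * Umat A u (q + s • v).1 (q + s • v).2 * Qᵀ) j k)
      ((Q * Umat A u q.1 q.2 * Qᵀ) j k)
      (dd v (dd (spat (Q j)) (dd (spat (Q k)) g)) q +
        fderiv ℝ (frameEntry A Q j k) (q, xgrad g q) (v, xgrad (dd v g) q))
      (dd v (dd v (dd (spat (Q j)) (dd (spat (Q k)) g))) q +
        (fderiv ℝ (fderiv ℝ (frameEntry A Q j k)) (q, xgrad g q) (v, xgrad (dd v g) q)
          (v, xgrad (dd v g) q) +
        fderiv ℝ (frameEntry A Q j k) (q, xgrad g q) (0, xgrad (dd v (dd v g)) q))) := by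
  have h2 : ContDiff ℝ 2 g := contDiff_two_of_nat (by norm_num) hg
  have h3 : ContDiff ℝ ((3 : ℕ) : ℕ∞) g := hg.of_le (by norm_cast)
  have hh : ContDiff ℝ 2 (dd (spat (Q j)) (dd (spat (Q k)) g)) := by
    exact_mod_cast dd_contDiff (k := 2) (dd_contDiff (k := 3) hg _) _
  have := (hasJet_along hh q v).add (HasJet.comp (frameEntry_contDiff hA Q j k)
    ((hasJet_line q v).prodMk (hasJet_xgrad h3 q v)))
  subst hgu
  simpa only [frame_Umat h2] using this

end Frame

/-! ### Conditions at an interior maximum point -/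

section InteriorPoint

variable {n : ℕ} {Ω : Set (Fin n → ℝ)} {T : ℝ} {Γ : Set (Fin n → ℝ)} {f : (Fin n → ℝ) → ℝ}
  {A : (Fin n → ℝ) → ℝ → (Fin n → ℝ) → Mat n} {ψ : (Fin n → ℝ) → ℝ → ℝ → (Fin n → ℝ) → ℝ}
  {u : (Fin n → ℝ) → ℝ → ℝ} {g : (Fin n → ℝ) × ℝ → ℝ}

/-- `ψ` as a function of a single variable. -/
def psiFun (ψ : (Fin n → ℝ) → ℝ → ℝ → (Fin n → ℝ) → ℝ) :
    ((Fin n → ℝ) × ℝ) × ℝ × (Fin n → ℝ) → ℝ :=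
  fun z => ψ z.1.1 z.1.2 z.2.1 z.2.2

lemma QT_subset_QTbar : QT Ω T ⊆ QTbar Ω T :=
  Set.prod_mono subset_closure Set.Ioc_subset_Icc_self

lemma eventually_mem_QT (hΩ : IsOpen Ω) {q : (Fin n → ℝ) × ℝ} (hq : q ∈ QT Ω T) (ξ : Fin n → ℝ) :
    ∀ᶠ s : ℝ in 𝓝 0, q + s • spat ξ ∈ QT Ω T := by
  have hc : Continuous fun s : ℝ => q.1 + s • ξ := by fun_prop
  have : ∀ᶠ s : ℝ in 𝓝 0, q.1 + s • ξ ∈ Ω :=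
    hc.continuousAt.eventually_mem (hΩ.mem_nhds (by simpa using hq.1))
  filter_upwards [this] with s hs
  exact ⟨by simpa [spat] using hs, by simpa [spat] using hq.2⟩

lemma HasJet.hasDerivAt {F : Type*} [NormedAddCommGroup F] [NormedSpace ℝ F] {φ : ℝ → F}
    {a b c : F} (h : HasJet φ a b c) : HasDerivAt φ b 0 := by
  obtain ⟨p, hp, _, h1, _⟩ := h
  exact h1 ▸ hp 0

/-- The equation differentiated once and twice in a spatial direction. -/
lemma differentiated_equation (hΓ : GoodCone Γ) (hfs : SmoothSymF Γ f) (hf2 : F2cond Γ f)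
    (hA : ASmooth A) (hψ : PsiSmooth ψ) (hΩ : IsOpen Ω) (hgu : g = fun q => u q.1 q.2)
    (hg : ContDiff ℝ ((4 : ℕ) : ℕ∞) g) (hadm : Admissible Γ A u (QTbar Ω T))
    (hE : SolvesE f A ψ u (QT Ω T)) {q : (Fin n → ℝ) × ℝ} (hq : q ∈ QT Ω T) {Q : Mat n}
    (hQ : Q * Qᵀ = 1) {lam : Fin n → ℝ} (hlam : lam = eigenVec (Umat A u q.1 q.2))
    (hQU : Q * Umat A u q.1 q.2 * Qᵀ = Matrix.diagonal lam) {i₀ : Fin n} {b : Fin n → ℝ}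
    (hb : b i₀ = 0) {ξ : Fin n → ℝ} {v : (Fin n → ℝ) × ℝ} (hv : v = spat ξ) :
    ∑ i, fLam f lam i * (dd v (dd (spat (Q i)) (dd (spat (Q i)) g)) q +
        fderiv ℝ (frameEntry A Q i i) (q, xgrad g q) (v, xgrad (dd v g) q)) =
      dd v (dd timeVec g) q +
        fderiv ℝ (psiFun ψ) (q, (g q, xgrad g q)) (v, (dd v g q, xgrad (dd v g) q)) ∧
    dd v (dd v (dd timeVec g)) q +
        (fderiv ℝ (fderiv ℝ (psiFun ψ)) (q, (g q, xgrad g q)) (v, (dd v g q, xgrad (dd v g) q))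
          (v, (dd v g q, xgrad (dd v g) q)) +
        fderiv ℝ (psiFun ψ) (q, (g q, xgrad g q))
          (0, (dd v (dd v g) q, xgrad (dd v (dd v g)) q))) ≤
      ∑ i, fLam f lam i * (dd v (dd v (dd (spat (Q i)) (dd (spat (Q i)) g))) q +
        (fderiv ℝ (fderiv ℝ (frameEntry A Q i i)) (q, xgrad g q) (v, xgrad (dd v g) q)
          (v, xgrad (dd v g) q) +
        fderiv ℝ (frameEntry A Q i i) (q, xgrad g q) (0, xgrad (dd v (dd v g)) q))) +
      ∑ k, (4 * ((fLam f lam k - fLam f lam i₀) * (b k *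
            (dd v (dd (spat (Q i₀)) (dd (spat (Q k)) g)) q +
              fderiv ℝ (frameEntry A Q i₀ k) (q, xgrad g q) (v, xgrad (dd v g) q)))) +
          2 * (b k ^ 2 * ((fLam f lam k - fLam f lam i₀) * (lam i₀ - lam k)))) := by
  have h2 : ContDiff ℝ 2 g := contDiff_two_of_nat (by norm_num) hg
  have h3 : ContDiff ℝ ((3 : ℕ) : ℕ∞) g := hg.of_le (by norm_cast)
  have hgd : Differentiable ℝ g := h2.differentiable (by norm_num)
  have hψ2 : ContDiff ℝ 2 (psiFun ψ) := contDiff_infty.1 hψ 2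
  have hgt : ContDiff ℝ 2 (dd timeVec g) := contDiff_two_of_nat (k := 3) (by norm_num)
    (dd_contDiff hg _)
  have hlamΓ : lam ∈ Γ := hlam ▸ hadm q (QT_subset_QTbar hq)
  have hr := (hasJet_along hgt q v).add (HasJet.comp hψ2 ((hasJet_line q v).prodMk
    ((hasJet_along h2 q v).prodMk (hasJet_xgrad h3 q v))))
  have hEq : ∀ q ∈ QT Ω T, f (eigenVec (Umat A u q.1 q.2)) =
      dd timeVec g q + psiFun ψ (q, (g q, xgrad g q)) := fun q hq => by
    have := hE q hq
    rw [deriv_time _ _ (hgu ▸ hgd _), sgrad_eq_xgrad _ _ (hgu ▸ hgd _), ← hgu] at this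
    simp only [psiFun]
    rw [sub_eq_iff_eq_add] at this
    rw [this, add_comm, hgu]
  have hU := fun i j => hasJet_frame hA hgu hg Q q v i j
  refine curve_conditions hΓ hfs hf2 (S := fun s => Umat A u (q + s • v).1 (q + s • v).2)
    (V := Matrix.of fun i j => dd v (dd (spat (Q i)) (dd (spat (Q j)) g)) q +
        fderiv ℝ (frameEntry A Q i j) (q, xgrad g q) (v, xgrad (dd v g) q))
    (W := Matrix.of fun i j => dd v (dd v (dd (spat (Q i)) (dd (spat (Q j)) g))) q +
        (fderiv ℝ (fderiv ℝ (frameEntry A Q i j)) (q, xgrad g q) (v, xgrad (dd v g) q)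
          (v, xgrad (dd v g) q) +
        fderiv ℝ (frameEntry A Q i j) (q, xgrad g q) (0, xgrad (dd v (dd v g)) q)))
    hQ hlamΓ ?_ hr (hlam ▸ hEq q hq) ?_ (fun i j => ?_) hb
  · filter_upwards [eventually_mem_QT hΩ hq ξ] with s hs
    rw [← hv] at hs
    exact ⟨Umat_isSymm hA (hgu ▸ h2) _ _, hadm _ (QT_subset_QTbar hs), hEq _ hs⟩
  · ext i j
    simp only [Matrix.transpose_apply, Matrix.of_apply]
    rw [frameEntry_symm hA, dd_comm h2]
  · simp only [Matrix.of_apply]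
    rw [← hQU]
    exact hU i j

/-- Conditions at a maximum point of `U₁₁ exp η`. -/
lemma maximum_conditions (hA : ASmooth A) (hΩ : IsOpen Ω) (hgu : g = fun q => u q.1 q.2)
    (hg : ContDiff ℝ ((4 : ℕ) : ℕ∞) g) {q : (Fin n → ℝ) × ℝ} (hq : q ∈ QT Ω T) {Q : Mat n}
    {i : Fin n} {η : (Fin n → ℝ) × ℝ → ℝ} (hη : ContDiff ℝ 2 η) {L : ℝ}
    (hL : (Q * Umat A u q.1 q.2 * Qᵀ) i i = L)
    (hmax : ∀ q' ∈ QTbar Ω T, (Q * Umat A u q'.1 q'.2 * Qᵀ) i i * Real.exp (η q') ≤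
      (Q * Umat A u q.1 q.2 * Qᵀ) i i * Real.exp (η q)) :
    (∀ ξ : Fin n → ℝ, dd (spat ξ) (dd (spat (Q i)) (dd (spat (Q i)) g)) q +
        fderiv ℝ (frameEntry A Q i i) (q, xgrad g q) (spat ξ, xgrad (dd (spat ξ) g) q) =
          -(L * dd (spat ξ) η q)) ∧
    (∀ ξ : Fin n → ℝ, dd (spat ξ) (dd (spat ξ) (dd (spat (Q i)) (dd (spat (Q i)) g))) q +
        (fderiv ℝ (fderiv ℝ (frameEntry A Q i i)) (q, xgrad g q)
          (spat ξ, xgrad (dd (spat ξ) g) q) (spat ξ, xgrad (dd (spat ξ) g) q) +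
        fderiv ℝ (frameEntry A Q i i) (q, xgrad g q)
          (0, xgrad (dd (spat ξ) (dd (spat ξ) g)) q)) +
        L * dd (spat ξ) (dd (spat ξ) η) q - L * dd (spat ξ) η q ^ 2 ≤ 0) ∧
    0 ≤ dd timeVec (dd (spat (Q i)) (dd (spat (Q i)) g)) q +
        fderiv ℝ (frameEntry A Q i i) (q, xgrad g q) (timeVec, xgrad (dd timeVec g) q) +
        L * dd timeVec η q := by
  subst hL
  have hloc : ∀ ξ : Fin n → ℝ, _ ∧ _ := fun ξ =>
    mul_exp_localMax (hasJet_frame hA hgu hg Q q (spat ξ) i i) (hasJet_along hη q (spat ξ)) (by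
      filter_upwards [eventually_mem_QT hΩ hq ξ] with s hs
      simpa using hmax _ (QT_subset_QTbar hs))
  refine ⟨fun ξ => (hloc ξ).1, fun ξ => (hloc ξ).2, ?_⟩
  have h1 := (hasJet_frame hA hgu hg Q q timeVec i i).hasDerivAt.mul
    (hasJet_along hη q timeVec).hasDerivAt.exp
  have h2 := hasDerivAt_nonneg_of_le h1 (by
    have : ∀ᶠ s : ℝ in 𝓝[<] 0, -q.2 < s :=
      nhdsWithin_le_nhds (lt_mem_nhds (by simpa using hq.2.1))
    filter_upwards [this, self_mem_nhdsWithin] with s hs hs0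
    have hs0' : s < 0 := hs0
    have hmem : q + s • timeVec ∈ QTbar Ω T :=
      ⟨by simpa [timeVec] using subset_closure hq.1,
        by constructor <;> simp [timeVec] <;> linarith [hq.2.2]⟩
    simpa using hmax _ hmem)
  simp only [zero_smul, add_zero] at h2
  have h3 : 0 < Real.exp (η q) := Real.exp_pos _
  nlinarith

end InteriorPoint

/-! ### The auxiliary exponent -/

section Exponent

variable {n : ℕ}

lemma HasJet.unique {F : Type*} [NormedAddCommGroup F] [NormedSpace ℝ F] {φ : ℝ → F}
    {a b c a' b' c' : F} (h : HasJet φ a b c) (h' : HasJet φ a' b' c') : b = b' ∧ c = c' := by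
  obtain ⟨p, hp, _, h1, h2⟩ := h
  obtain ⟨p', hp', _, h1', h2'⟩ := h'
  obtain rfl : p = p' := funext fun s => (hp s).unique (hp' s)
  exact ⟨h1.symm.trans h1', h2.unique h2'⟩

/-- The exponent `δ |Dg|² / 2 + N (gb - g) - M t`. -/
def exponent (δ N M : ℝ) (g gb : (Fin n → ℝ) × ℝ → ℝ) : (Fin n → ℝ) × ℝ → ℝ :=
  fun q => δ / 2 * ∑ l, xgrad g q l ^ 2 + N * (gb q - g q) - M * q.2

variable {δ N M : ℝ} {g gb : (Fin n → ℝ) × ℝ → ℝ}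

lemma exponent_contDiff (hg : ContDiff ℝ ((4 : ℕ) : ℕ∞) g) (hgb : ContDiff ℝ 2 gb) :
    ContDiff ℝ 2 (exponent δ N M g gb) := by
  have h2 : ContDiff ℝ 2 g := contDiff_two_of_nat (by norm_num) hg
  have hl : ∀ l, ContDiff ℝ 2 fun q => xgrad g q l := fun l =>
    contDiff_two_of_nat (k := 3) (by norm_num) (dd_contDiff hg _)
  unfold exponent
  exact ((contDiff_const.mul (ContDiff.sum fun l _ => (hl l).pow 2)).add
    (contDiff_const.mul (hgb.sub h2))).sub (contDiff_const.mul contDiff_snd)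

lemma dd_exponent (hg : ContDiff ℝ ((4 : ℕ) : ℕ∞) g) (hgb : ContDiff ℝ 2 gb)
    (q v : (Fin n → ℝ) × ℝ) :
    dd v (exponent δ N M g gb) q = δ * ∑ l, xgrad g q l * xgrad (dd v g) q l +
        N * (dd v gb q - dd v g q) - M * v.2 ∧
    dd v (dd v (exponent δ N M g gb)) q =
      δ * (∑ l, xgrad (dd v g) q l ^ 2 + ∑ l, xgrad g q l * xgrad (dd v (dd v g)) q l) +
        N * (dd v (dd v gb) q - dd v (dd v g) q) := by
  have h2 : ContDiff ℝ 2 g := contDiff_two_of_nat (by norm_num) hg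
  have h3 : ContDiff ℝ ((3 : ℕ) : ℕ∞) g := hg.of_le (by norm_cast)
  have hx : ∀ l, HasJet (fun s : ℝ => xgrad g (q + s • v) l) (xgrad g q l)
      (xgrad (dd v g) q l) (xgrad (dd v (dd v g)) q l) := fun l => by
    have := HasJet.comp (g := fun p : Fin n → ℝ => p l) (contDiff_apply ℝ ℝ l) (hasJet_xgrad h3 q v)
    have hf : fderiv ℝ (fun p : Fin n → ℝ => p l) =
        fun _ => ContinuousLinearMap.proj (R := ℝ) (φ := fun _ : Fin n => ℝ) l :=
      funext fun p => (ContinuousLinearMap.proj (R := ℝ) (φ := fun _ : Fin n => ℝ) l).fderiv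
    simpa [hf] using this
  have ht := HasJet.comp (g := fun p : (Fin n → ℝ) × ℝ => p.2) contDiff_snd (hasJet_line q v)
  have hf : fderiv ℝ (fun p : (Fin n → ℝ) × ℝ => p.2) =
      fun _ => ContinuousLinearMap.snd ℝ (Fin n → ℝ) ℝ :=
    funext fun p => (ContinuousLinearMap.snd ℝ (Fin n → ℝ) ℝ).fderiv
  have h := (((HasJet.sum (s := Finset.univ) fun l _ => (hx l).mul (hx l)).const_mul (δ / 2)).add
    (((hasJet_along hgb q v).sub (hasJet_along h2 q v)).const_mul N)).sub (ht.const_mul M)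
  have hfun : (fun s : ℝ => exponent δ N M g gb (q + s • v)) = fun s : ℝ =>
      δ / 2 * ∑ l, xgrad g (q + s • v) l * xgrad g (q + s • v) l +
        N * (gb (q + s • v) - g (q + s • v)) - M * (q + s • v).2 := by
    funext s
    simp only [exponent, sq]
  have h' := hasJet_along (exponent_contDiff (δ := δ) (N := N) (M := M) hg hgb) q v
  rw [hfun] at h'
  obtain ⟨e1, e2⟩ := h'.unique h
  constructor
  · rw [e1, hf]
    simp only [ContinuousLinearMap.coe_snd', Finset.mul_sum]
    congr 2
    exact Finset.sum_congr rfl fun l _ => by ring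
  · rw [e2, hf]
    simp only [fderiv_fun_const, Pi.zero_apply, zero_apply, map_zero, add_zero,
      mul_zero, sub_zero, Finset.mul_sum, ← Finset.sum_add_distrib]
    congr 1
    exact Finset.sum_congr rfl fun l _ => by ring

end Exponent

/-! ### Combining the pointwise conditions -/

section Combination

variable {n : ℕ}

lemma clm_abs_le {V : Type*} [NormedAddCommGroup V] [NormedSpace ℝ V] {ℓ : V →L[ℝ] ℝ} {c r : ℝ}
    {v : V} (hℓ : ‖ℓ‖ ≤ c) (hv : ‖v‖ ≤ r) : |ℓ v| ≤ c * r :=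
  (ℓ.le_opNorm v).trans (mul_le_mul hℓ hv (norm_nonneg _) ((norm_nonneg _).trans hℓ))

lemma clm_abs_le₂ {V : Type*} [NormedAddCommGroup V] [NormedSpace ℝ V] {B : V →L[ℝ] V →L[ℝ] ℝ}
    {c r s : ℝ} {v w : V} (hB : ‖B‖ ≤ c) (hv : ‖v‖ ≤ r) (hw : ‖w‖ ≤ s) :
    |B v w| ≤ c * r * s := by
  refine clm_abs_le ((B.le_opNorm v).trans ?_) hw
  have hc : 0 ≤ c := le_trans (norm_nonneg B) hB
  exact mul_le_mul hB hv (norm_nonneg _) hc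

lemma norm_prodMk_le {V W : Type*} [SeminormedAddCommGroup V] [SeminormedAddCommGroup W] {v : V}
    {w : W} {r : ℝ} (hv : ‖v‖ ≤ r) (hw : ‖w‖ ≤ r) : ‖(v, w)‖ ≤ r := by
  rw [Prod.norm_mk]; exact max_le hv hw

lemma add_diag {V : Type*} [NormedAddCommGroup V] [NormedSpace ℝ V] (B : V →L[ℝ] V →L[ℝ] ℝ)
    (v w : V) : B (v + w) (v + w) = B v v + B v w + B w v + B w w := by
  simp only [map_add, add_apply]
  ring

/-- The `U₁₁`-part of the combined inequality. -/
lemma combined_inequality {c L ut11 g1 g11 et Bt : ℝ} (hc : 1 ≤ c) (hL : 1 ≤ L)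
    {a1 : ((Fin n → ℝ) × ℝ) × (Fin n → ℝ) →L[ℝ] ℝ}
    {a2 : ((Fin n → ℝ) × ℝ) × (Fin n → ℝ) →L[ℝ] ((Fin n → ℝ) × ℝ) × (Fin n → ℝ) →L[ℝ] ℝ}
    {da : Fin n → ((Fin n → ℝ) × ℝ) × (Fin n → ℝ) →L[ℝ] ℝ}
    {d2a : Fin n → ((Fin n → ℝ) × ℝ) × (Fin n → ℝ) →L[ℝ]
      ((Fin n → ℝ) × ℝ) × (Fin n → ℝ) →L[ℝ] ℝ}
    {dψ : ((Fin n → ℝ) × ℝ) × ℝ × (Fin n → ℝ) →L[ℝ] ℝ}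
    {d2ψ : ((Fin n → ℝ) × ℝ) × ℝ × (Fin n → ℝ) →L[ℝ]
      ((Fin n → ℝ) × ℝ) × ℝ × (Fin n → ℝ) →L[ℝ] ℝ}
    (ha1 : ‖a1‖ ≤ c) (ha2 : ‖a2‖ ≤ c) (hda : ∀ i, ‖da i‖ ≤ c) (hd2a : ∀ i, ‖d2a i‖ ≤ c)
    (hdψ : ‖dψ‖ ≤ c) (hd2ψ : ‖d2ψ‖ ≤ c)
    (hconc : ∀ i π, d2a i (0, π) (0, π) ≤ 0) (hconv : ∀ π, 0 ≤ d2ψ (0, (0, π)) (0, (0, π)))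
    {F lam m e1 e2 : Fin n → ℝ} {y : Fin n → ((Fin n → ℝ) × ℝ) × (Fin n → ℝ)}
    {w : Fin n → Fin n → ℝ} {v1 τ : (Fin n → ℝ) × ℝ} {h1 w1 dut ρ α Dη : Fin n → ℝ}
    (hF : ∀ i, 0 < F i) (hy : ∀ i, ‖y i‖ ≤ c * (|lam i| + 1)) (hv1 : ‖v1‖ ≤ 1) (hτ : ‖τ‖ ≤ 1)
    (hh1 : ‖h1‖ ≤ c * L) (hg1 : |g1| ≤ c) (hg11 : |g11| ≤ c * L)
    (heq : ut11 + (d2ψ (v1, (g1, h1)) (v1, (g1, h1)) + dψ (0, (g11, w1))) ≤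
      ∑ i, F i * (m i + (d2a i (v1, h1) (v1, h1) + da i (0, w1))) + Bt)
    (hsp : ∀ i, m i + (a2 (y i) (y i) + a1 (0, w i)) + L * e2 i - L * e1 i ^ 2 ≤ 0)
    (htime : 0 ≤ ut11 + a1 (τ, dut) + L * et)
    (hω : ∑ i, F i • w i = dut + ρ) (hρ : ‖ρ‖ ≤ c * (1 + ∑ i, F i) * L)
    (hw1 : w1 = -(L • Dη) - α) (hα : ‖α‖ ≤ c * L) :
    L * (∑ i, F i * e2 i - et + (∑ i, F i * da i (0, Dη) - dψ (0, (0, Dη))) -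
        ∑ i, F i * e1 i ^ 2)
      - 12 * c ^ 3 * (1 + ∑ i, F i) * L - 12 * c ^ 3 * (∑ i, F i * lam i ^ 2) - Bt ≤ 0 := by
  set S := ∑ i, F i with hS
  have hS0 : 0 ≤ S := Finset.sum_nonneg fun i _ => (hF i).le
  have hc0 : 0 ≤ c := by linarith
  have hL0 : 0 ≤ L := by linarith
  have k1 : -(2 * c ^ 3 * (∑ i, F i * lam i ^ 2 + S)) ≤ ∑ i, F i * a2 (y i) (y i) := by
    have : ∀ i, -(2 * c ^ 3 * (F i * lam i ^ 2 + F i)) ≤ F i * a2 (y i) (y i) := fun i => by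
      have h := (abs_le.1 (clm_abs_le₂ ha2 (hy i) (hy i))).1
      have h' : (|lam i| + 1) ^ 2 ≤ 2 * (lam i ^ 2 + 1) := by
        rw [← sq_abs (lam i)]; nlinarith [sq_nonneg (|lam i| - 1)]
      have h2 : c * (c * (|lam i| + 1)) * (c * (|lam i| + 1)) ≤ 2 * c ^ 3 * (lam i ^ 2 + 1) := by
        calc _ = c ^ 3 * (|lam i| + 1) ^ 2 := by ring
          _ ≤ c ^ 3 * (2 * (lam i ^ 2 + 1)) := by gcongr
          _ = _ := by ring
      have h3 := mul_le_mul_of_nonneg_left (by linarith : -(2 * c ^ 3 * (lam i ^ 2 + 1)) ≤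
        a2 (y i) (y i)) (hF i).le
      linarith
    calc _ = ∑ i, -(2 * c ^ 3 * (F i * lam i ^ 2 + F i)) := by
          rw [Finset.sum_neg_distrib, ← Finset.mul_sum, Finset.sum_add_distrib]
      _ ≤ _ := Finset.sum_le_sum fun i _ => this i
  have k2 : ∑ i, F i * a1 (0, w i) = a1 (τ, dut) + a1 (0, ρ) - a1 (τ, 0) := by
    have : ∑ i, F i * a1 (0, w i) = a1 (0, ∑ i, F i • w i) := by
      have e : ((0 : (Fin n → ℝ) × ℝ), ∑ i, F i • w i) =
          ∑ i, F i • ((0 : (Fin n → ℝ) × ℝ), w i) := by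
        refine Prod.ext ?_ ?_
        · rw [Prod.fst_sum]; simp
        · rw [Prod.snd_sum]; simp
      rw [e, map_sum]
      exact Finset.sum_congr rfl fun i _ => by rw [map_smul, smul_eq_mul]
    rw [this, hω, ← map_add, ← map_sub]
    congr 1
    simp
  have k3 := (abs_le.1 (clm_abs_le ha1 (norm_prodMk_le (v := (0 : (Fin n → ℝ) × ℝ))
    (by simp; positivity) hρ))).1
  have k4 := (abs_le.1 (clm_abs_le ha1 (norm_prodMk_le (w := (0 : Fin n → ℝ)) hτ
    (by simp)))).2
  have k5 : -(c * c * c + 2 * (c * c * (c * L))) ≤ d2ψ (v1, (g1, h1)) (v1, (g1, h1)) := by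
    have e : (v1, (g1, h1)) = (v1, (g1, (0 : Fin n → ℝ))) +
        ((0 : (Fin n → ℝ) × ℝ), ((0 : ℝ), h1)) := by simp
    rw [e, add_diag]
    have n1 : ‖(v1, (g1, (0 : Fin n → ℝ)))‖ ≤ c :=
      norm_prodMk_le (hv1.trans hc) (norm_prodMk_le hg1 (by simpa))
    have n2 : ‖((0 : (Fin n → ℝ) × ℝ), ((0 : ℝ), h1))‖ ≤ c * L :=
      norm_prodMk_le (by simp; positivity) (norm_prodMk_le (by simp; positivity) hh1)
    have h1' := (abs_le.1 (clm_abs_le₂ hd2ψ n1 n1)).1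
    have h2' := (abs_le.1 (clm_abs_le₂ hd2ψ n1 n2)).1
    have h3' := (abs_le.1 (clm_abs_le₂ hd2ψ n2 n1)).1
    have h4' := hconv h1
    linarith
  have k6 : ∑ i, F i * d2a i (v1, h1) (v1, h1) ≤ S * (c + 2 * (c * (c * L))) := by
    rw [hS, Finset.sum_mul]
    refine Finset.sum_le_sum fun i _ => mul_le_mul_of_nonneg_left ?_ (hF i).le
    have e : (v1, h1) = (v1, (0 : Fin n → ℝ)) + ((0 : (Fin n → ℝ) × ℝ), h1) := by simp
    rw [e, add_diag]
    have n1 : ‖(v1, (0 : Fin n → ℝ))‖ ≤ 1 := norm_prodMk_le hv1 (by simp)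
    have n2 : ‖((0 : (Fin n → ℝ) × ℝ), h1)‖ ≤ c * L := norm_prodMk_le (by simp; positivity) hh1
    have h1' := (abs_le.1 (clm_abs_le₂ (hd2a i) n1 n1)).2
    have h2' := (abs_le.1 (clm_abs_le₂ (hd2a i) n1 n2)).2
    have h3' := (abs_le.1 (clm_abs_le₂ (hd2a i) n2 n1)).2
    have h4' := hconc i h1
    linarith
  have k7 : dψ (0, (g11, w1)) =
      dψ (0, (g11, 0)) - L * dψ (0, (0, Dη)) - dψ (0, (0, α)) := by
    rw [hw1, ← smul_eq_mul, ← map_smul, ← map_sub, ← map_sub]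
    congr 1
    simp
  have k8 := (abs_le.1 (clm_abs_le hdψ (v := (0, (g11, 0))) (r := c * L)
    (norm_prodMk_le (by simp; positivity) (norm_prodMk_le hg11 (by simp; positivity))))).1
  have k9 := (abs_le.1 (clm_abs_le hdψ (v := (0, (0, α))) (r := c * L)
    (norm_prodMk_le (by simp; positivity) (norm_prodMk_le (by simp; positivity) hα)))).2
  have k10 : ∑ i, F i * da i (0, w1) =
      -(L * ∑ i, F i * da i (0, Dη)) - ∑ i, F i * da i (0, α) := by
    rw [Finset.mul_sum, ← Finset.sum_neg_distrib, ← Finset.sum_sub_distrib]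
    refine Finset.sum_congr rfl fun i _ => ?_
    have : da i (0, w1) = -(L * da i (0, Dη)) - da i (0, α) := by
      rw [hw1, ← smul_eq_mul, ← map_smul, ← map_neg, ← map_sub]
      congr 1
      simp
    rw [this]; ring
  have k11 : -(S * (c * (c * L))) ≤ ∑ i, F i * da i (0, α) := by
    rw [hS, Finset.sum_mul, ← Finset.sum_neg_distrib]
    refine Finset.sum_le_sum fun i _ => ?_
    have := (abs_le.1 (clm_abs_le (hda i) (v := (0, α)) (r := c * L)
      (norm_prodMk_le (by simp; positivity) hα))).1
    have := mul_le_mul_of_nonneg_left this (hF i).le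
    linarith
  have hsum : ∑ i, F i * m i + (∑ i, F i * a2 (y i) (y i) + ∑ i, F i * a1 (0, w i)) +
      L * ∑ i, F i * e2 i - L * ∑ i, F i * e1 i ^ 2 ≤ 0 := by
    rw [Finset.mul_sum, Finset.mul_sum, ← Finset.sum_add_distrib, ← Finset.sum_add_distrib,
      ← Finset.sum_add_distrib, ← Finset.sum_sub_distrib]
    refine Finset.sum_nonpos fun i _ => ?_
    have := mul_nonpos_of_nonneg_of_nonpos (hF i).le (hsp i)
    linarith
  have heq' : ∑ i, F i * (m i + (d2a i (v1, h1) (v1, h1) + da i (0, w1))) =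
      ∑ i, F i * m i + (∑ i, F i * d2a i (v1, h1) (v1, h1) + ∑ i, F i * da i (0, w1)) := by
    simp only [mul_add, Finset.sum_add_distrib]
  have hc2 : c ^ 2 ≤ c ^ 3 := pow_le_pow_right₀ hc (by norm_num)
  have hc1 : c ≤ c ^ 3 := by simpa using pow_le_pow_right₀ hc (show 1 ≤ 3 by norm_num)
  have hSL : S ≤ S * L := le_mul_of_one_le_right hS0 hL
  have hc3 : 0 ≤ c ^ 3 := by positivity
  have t1 : c ^ 3 * S ≤ c ^ 3 * (S * L) := by gcongr
  have t2 : c ^ 2 * L ≤ c ^ 3 * L := by gcongr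
  have t3 : c ^ 2 * (S * L) ≤ c ^ 3 * (S * L) := by gcongr
  have t4 : c ≤ c ^ 3 * L := hc1.trans (le_mul_of_one_le_right hc3 hL)
  have t5 : c ^ 3 ≤ c ^ 3 * L := le_mul_of_one_le_right hc3 hL
  have t6 : S * c ≤ c ^ 3 * (S * L) := by
    calc S * c ≤ (S * L) * c ^ 3 := by gcongr
      _ = _ := by ring
  have t7 : 0 ≤ c ^ 3 * L := by positivity
  have t8 : 0 ≤ c ^ 3 * (S * L) := by positivity
  have t9 : 0 ≤ c ^ 3 * (∑ i, F i * lam i ^ 2) :=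
    mul_nonneg hc3 (Finset.sum_nonneg fun i _ => mul_nonneg (hF i).le (sq_nonneg _))
  rw [heq', k10, k7] at heq
  rw [k2] at hsum
  linarith

/-- Lower bound for the linearized operator applied to the exponent. -/
lemma linearized_exponent_lower {c δ N M θ et gt gbt ψ0 : ℝ} (hc : 1 ≤ c)
    (hδ : 0 < δ) (hδ1 : δ ≤ 1) (hN : 0 ≤ N)
    {da : Fin n → ((Fin n → ℝ) × ℝ) × (Fin n → ℝ) →L[ℝ] ℝ}
    {dψ : ((Fin n → ℝ) × ℝ) × ℝ × (Fin n → ℝ) →L[ℝ] ℝ}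
    (hda : ∀ i, ‖da i‖ ≤ c) (hdψ : ‖dψ‖ ≤ c)
    {F lam e2 gii gbii ai abi : Fin n → ℝ} {h w : Fin n → Fin n → ℝ} {P : (Fin n → ℝ) × ℝ}
    {p pb hp dut Dη : Fin n → ℝ}
    (hF : ∀ i, 0 < F i) (hP : ‖P‖ ≤ c) (hpp : |∑ l, p l * p l| ≤ c) (hppb : ‖pb - p‖ ≤ 2 * c)
    (hh : ∀ i, lam i ^ 2 / 2 - c ≤ ∑ l, h i l ^ 2)
    (he2 : ∀ i, e2 i = δ * (∑ l, h i l ^ 2 + ∑ l, p l * w i l) + N * (gbii i - gii i))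
    (het : et = δ * ∑ l, p l * dut l + N * (gbt - gt) - M)
    (hDη : Dη = δ • hp + N • (pb - p))
    (heq : ∑ i, F i * (∑ l, p l * w i l + da i (P, hp)) =
      ∑ l, p l * dut l + dψ (P, (∑ l, p l * p l, hp)))
    (hlam : ∀ i, gii i + ai i = lam i) (hconc : ∀ i, abi i ≤ ai i + da i (0, pb - p))
    (hsub : 0 ≤ ∑ i, F i * (gbii i + abi i - θ)) (hFlam : ∑ i, F i * lam i ≤ gt + ψ0)
    (hψ0 : |ψ0| ≤ c) (hgbt : |gbt| ≤ c) :
    δ / 2 * (∑ i, F i * lam i ^ 2) + N * θ * (∑ i, F i) - 4 * c ^ 2 * (1 + ∑ i, F i) -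
      4 * c ^ 2 * N + M ≤
    ∑ i, F i * e2 i - et + (∑ i, F i * da i (0, Dη) - dψ (0, (0, Dη))) := by
  set S := ∑ i, F i with hS
  have hS0 : 0 ≤ S := Finset.sum_nonneg fun i _ => (hF i).le
  have s1 : (∑ i, F i * lam i ^ 2) / 2 - c * S ≤ ∑ i, F i * ∑ l, h i l ^ 2 := by
    have := Finset.sum_le_sum fun i (_ : i ∈ Finset.univ) =>
      mul_le_mul_of_nonneg_left (hh i) (hF i).le
    refine le_trans (le_of_eq ?_) this
    rw [hS, Finset.mul_sum, Finset.sum_div, ← Finset.sum_sub_distrib]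
    exact Finset.sum_congr rfl fun i _ => by ring
  have s2 : ∑ i, F i * e2 i = δ * (∑ i, F i * ∑ l, h i l ^ 2 + ∑ i, F i * ∑ l, p l * w i l) +
      N * ∑ i, F i * (gbii i - gii i) := by
    rw [mul_add, Finset.mul_sum, Finset.mul_sum, Finset.mul_sum, ← Finset.sum_add_distrib,
      ← Finset.sum_add_distrib]
    exact Finset.sum_congr rfl fun i _ => by rw [he2]; ring
  have s3 : ∑ i, F i * da i (0, Dη) =
      δ * (∑ i, F i * da i (P, hp) - ∑ i, F i * da i (P, 0)) +
        N * ∑ i, F i * da i (0, pb - p) := by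
    rw [← Finset.sum_sub_distrib, Finset.mul_sum, Finset.mul_sum, ← Finset.sum_add_distrib]
    refine Finset.sum_congr rfl fun i _ => ?_
    have : da i (0, Dη) = δ * (da i (P, hp) - da i (P, 0)) + N * da i (0, pb - p) := by
      rw [hDη, ← map_sub, ← smul_eq_mul, ← smul_eq_mul, ← map_smul, ← map_smul, ← map_add]
      congr 1
      simp
    rw [this]; ring
  have s4 : dψ (0, (0, Dη)) =
      δ * (dψ (P, (∑ l, p l * p l, hp)) - dψ (P, (∑ l, p l * p l, 0))) +
        N * dψ (0, (0, pb - p)) := by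
    rw [hDη, ← map_sub, ← smul_eq_mul, ← smul_eq_mul, ← map_smul, ← map_smul, ← map_add]
    congr 1
    simp
  have s5 : ∑ i, F i * (∑ l, p l * w i l + da i (P, hp)) =
      ∑ i, F i * ∑ l, p l * w i l + ∑ i, F i * da i (P, hp) := by
    simp only [mul_add, Finset.sum_add_distrib]
  have s6 : ∑ i, F i * da i (P, 0) ≤ S * (c * c) := by
    rw [hS, Finset.sum_mul]
    refine Finset.sum_le_sum fun i _ => mul_le_mul_of_nonneg_left ?_ (hF i).le
    exact (abs_le.1 (clm_abs_le (hda i) (norm_prodMk_le hP (by simp; linarith)))).2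
  have s7 := (abs_le.1 (clm_abs_le hdψ (v := (P, (∑ l, p l * p l, 0))) (r := c)
    (norm_prodMk_le hP (norm_prodMk_le hpp (by simp; linarith))))).1
  have s8 := (abs_le.1 (clm_abs_le hdψ (v := (0, (0, pb - p))) (r := 2 * c)
    (norm_prodMk_le (by simp; linarith) (norm_prodMk_le (by simp; linarith) hppb)))).2
  have s9 : θ * S - (gt + ψ0) ≤ ∑ i, F i * (gbii i - gii i) + ∑ i, F i * da i (0, pb - p) := by
    have e1 : ∑ i, F i * (gbii i + abi i - θ) - ∑ i, F i * lam i ≤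
        ∑ i, F i * (gbii i - gii i) + ∑ i, F i * da i (0, pb - p) - θ * S := by
      rw [hS, Finset.mul_sum, ← Finset.sum_sub_distrib, ← Finset.sum_add_distrib,
        ← Finset.sum_sub_distrib]
      refine Finset.sum_le_sum fun i _ => ?_
      have := mul_le_mul_of_nonneg_left (hconc i) (hF i).le
      rw [← hlam i]
      linarith
    linarith
  have s10 : N * (θ * S - (gt + ψ0) - gbt + gt - c * (2 * c)) ≤
      N * (∑ i, F i * (gbii i - gii i) + ∑ i, F i * da i (0, pb - p) - gbt + gt -
        dψ (0, (0, pb - p))) := mul_le_mul_of_nonneg_left (by linarith) hN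
  have s11 : δ * ((∑ i, F i * lam i ^ 2) / 2 - c * S - c * c - S * (c * c)) ≤
      δ * (∑ i, F i * ∑ l, h i l ^ 2 + dψ (P, (∑ l, p l * p l, 0)) - ∑ i, F i * da i (P, 0)) :=
    mul_le_mul_of_nonneg_left (by linarith) hδ.le
  have s12 : N * (-(4 * c ^ 2)) ≤ N * (-ψ0 - gbt - c * (2 * c)) :=
    mul_le_mul_of_nonneg_left (by
      have h1 : c ≤ c ^ 2 := by simpa using pow_le_pow_right₀ hc (show 1 ≤ 2 by norm_num)
      linarith [(abs_le.1 hψ0).2, (abs_le.1 hgbt).2]) hN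
  have s13 : δ * (c * S + c * c + S * (c * c)) ≤ 4 * c ^ 2 * (1 + S) := by
    have : c * S + c * c + S * (c * c) ≤ 4 * c ^ 2 * (1 + S) := by
      have h1 : c ≤ c ^ 2 := by simpa using pow_le_pow_right₀ hc (show 1 ≤ 2 by norm_num)
      have h2 := mul_le_mul_of_nonneg_left h1 hS0
      have h3 := mul_nonneg hS0 (sq_nonneg c)
      have h4 := sq_nonneg c
      linarith
    refine le_trans (mul_le_of_le_one_left (by positivity) hδ1) this
  rw [s5] at heq
  have heq2 : δ * (∑ i, F i * ∑ l, p l * w i l + ∑ i, F i * da i (P, hp)) =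
    δ * (∑ l, p l * dut l + dψ (P, (∑ l, p l * p l, hp))) := by rw [heq]
  rw [s2, s3, s4, het]
  linarith

end Combination

/-! ### Pointwise facts about concavity and frames -/

section Concavity

variable {X : Type*} [NormedAddCommGroup X] [NormedSpace ℝ X]

lemma concave_line_conditions {G : X → ℝ} (hG : ContDiff ℝ 2 G) {y d : X}
    (hc : ConcaveOn ℝ Set.univ fun s : ℝ => G (y + s • d)) :
    G (y + d) ≤ G y + fderiv ℝ G y d ∧ fderiv ℝ (fderiv ℝ G) y d d ≤ 0 := by
  have hj := hasJet_along hG y d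
  have ht : ∀ s : ℝ, G (y + s • d) ≤ G y + dd d G y * s := fun s => by
    have h1 : HasDerivAt (fun r : ℝ => r * s) s 0 := by
      simpa using (hasDerivAt_id (0 : ℝ)).mul_const s
    have h0 : HasDerivAt (fun s : ℝ => G (y + s • d)) (dd d G y) (0 * s) := by
      simpa using hj.hasDerivAt
    have h2 : HasDerivAt (fun r : ℝ => G (y + (r * s) • d)) (dd d G y * s) 0 :=
      HasDerivAt.comp (h₂ := fun s : ℝ => G (y + s • d)) (h := fun r : ℝ => r * s) 0 h0 h1
    have h3 : G (y + s • d) - G y ≤ dd d G y * s := by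
      refine ge_of_tendsto h2.tendsto_slope_zero_right ?_
      filter_upwards [Ioc_mem_nhdsGT (zero_lt_one' ℝ)] with r hr
      have h1 := hc.2 (Set.mem_univ 0) (Set.mem_univ s) (sub_nonneg.2 hr.2) hr.1.le (by ring)
      simp only [smul_eq_mul, mul_zero, zero_add, zero_smul, add_zero, zero_mul] at h1 ⊢
      rw [le_inv_mul_iff₀ hr.1]
      linarith
    linarith
  refine ⟨by simpa [dd] using ht 1, ?_⟩
  have hlin : HasJet (fun s : ℝ => G y + dd d G y * s) (G y) (dd d G y) 0 :=
    ⟨fun _ => dd d G y, fun s => by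
      simpa using ((hasDerivAt_id s).const_mul (dd d G y)).const_add (G y), by simp, rfl,
      hasDerivAt_const _ _⟩
  have h := ((hlin.sub hj).eq_zero_and_nonneg_of_isLocalMin (Filter.Eventually.of_forall fun s => by
    have := ht s
    simp only [zero_smul, add_zero, mul_zero, sub_self]
    linarith)).2
  rw [dd_dd_eq hG] at h
  linarith

lemma concaveOn_line {V : Type*} [AddCommGroup V] [Module ℝ V] {φ : V → ℝ}
    (h : ConcaveOn ℝ Set.univ φ) (p π : V) : ConcaveOn ℝ Set.univ fun s : ℝ => φ (p + s • π) := by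
  refine ⟨convex_univ, fun s _ r _ a b ha hb hab => ?_⟩
  have := h.2 (Set.mem_univ (p + s • π)) (Set.mem_univ (p + r • π)) ha hb hab
  refine this.trans (le_of_eq ?_)
  congr 1
  rw [← eq_sub_iff_add_eq'] at hab
  subst hab
  simp only [smul_eq_mul]
  module

end Concavity

section Frames

variable {n : ℕ} {A : (Fin n → ℝ) → ℝ → (Fin n → ℝ) → Mat n}
  {ψ : (Fin n → ℝ) → ℝ → ℝ → (Fin n → ℝ) → ℝ} {Q : Mat n}

lemma frameEntry_concave (hA : ASmooth A) (hA2 : A2cond A ψ) (Q : Mat n) (i : Fin n)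
    (q : (Fin n → ℝ) × ℝ) (p π : Fin n → ℝ) :
    frameEntry A Q i i (q, p + π) ≤ frameEntry A Q i i (q, p) +
      fderiv ℝ (frameEntry A Q i i) (q, p) (0, π) ∧
    fderiv ℝ (fderiv ℝ (frameEntry A Q i i)) (q, p) (0, π) (0, π) ≤ 0 := by
  have h := concave_line_conditions (frameEntry_contDiff hA Q i i) (y := (q, p)) (d := (0, π)) (by
    convert concaveOn_line (hA2.2 q.1 q.2 (Q i)) p π using 2 with s
    simp [frameEntry, frame_apply, qform])
  simpa using h

lemma psiFun_convex (hψ : PsiSmooth ψ) (hA2 : A2cond A ψ) (q : (Fin n → ℝ) × ℝ) (z : ℝ)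
    (p π : Fin n → ℝ) :
    0 ≤ fderiv ℝ (fderiv ℝ (psiFun ψ)) (q, (z, p)) (0, (0, π)) (0, (0, π)) := by
  have hs : ContDiff ℝ 2 (psiFun ψ) := contDiff_infty.1 hψ 2
  have h := (concave_line_conditions hs.neg (y := (q, (z, p))) (d := (0, (0, π))) (by
    convert concaveOn_line (hA2.1 q.1 q.2 z) p π using 2 with s
    simp [psiFun])).2
  have e : fderiv ℝ (-psiFun ψ) = -fderiv ℝ (psiFun ψ) := funext fun _ => fderiv_neg
  have e' : fderiv ℝ (fun x => -psiFun ψ x) = -fderiv ℝ (psiFun ψ) := e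
  rw [e', fderiv_neg] at h
  simpa using h

lemma frame_row_sq (hQ : Q * Qᵀ = 1) (i : Fin n) : ∑ l, Q i l ^ 2 = 1 := by
  have h := congrFun (congrFun hQ i) i
  rw [Matrix.mul_apply, Matrix.one_apply_eq] at h
  rw [← h]
  exact Finset.sum_congr rfl fun l _ => by rw [Matrix.transpose_apply, sq]

lemma abs_frame_le (hQ : Q * Qᵀ = 1) (i l : Fin n) : |Q i l| ≤ 1 := by
  rw [← sq_le_one_iff_abs_le_one, ← frame_row_sq hQ i]
  exact Finset.single_le_sum (f := fun l => Q i l ^ 2) (fun l _ => sq_nonneg _) (Finset.mem_univ l)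

lemma norm_spat_le {ξ : Fin n → ℝ} {r : ℝ} (hr : 0 ≤ r) (h : ∀ l, |ξ l| ≤ r) : ‖spat ξ‖ ≤ r :=
  norm_prodMk_le ((pi_norm_le_iff_of_nonneg hr).2 h) (by simpa)

lemma abs_sum_mul_le {ξ ζ : Fin n → ℝ} {r s : ℝ} (hr : 0 ≤ r) (h : ∀ l, |ξ l| ≤ r)
    (h' : ∀ l, |ζ l| ≤ s) : |∑ l, ξ l * ζ l| ≤ n * (r * s) := by
  refine (Finset.abs_sum_le_sum_abs _ _).trans ?_
  calc _ ≤ ∑ _l : Fin n, r * s := Finset.sum_le_sum fun l _ => by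
        rw [abs_mul]; exact mul_le_mul (h l) (h' l) (abs_nonneg _) hr
    _ = _ := by simp

lemma frame_mul_eq {U : Mat n} {lam : Fin n → ℝ} (hQ : Q * Qᵀ = 1)
    (hQU : Q * U * Qᵀ = Matrix.diagonal lam) (i l : Fin n) :
    ∑ m, U l m * Q i m = lam i * Q i l := by
  have h : U * Qᵀ = Qᵀ * Matrix.diagonal lam := by
    rw [← hQU, ← Matrix.mul_assoc, ← Matrix.mul_assoc, mul_eq_one_comm.1 hQ, Matrix.one_mul]
  have h' := congrFun (congrFun h l) i
  rw [Matrix.mul_diagonal, Matrix.mul_apply, Matrix.transpose_apply] at h'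
  rw [mul_comm, ← h']
  rfl

lemma abs_entry_le {U : Mat n} {lam : Fin n → ℝ} {r : ℝ} (hQ : Q * Qᵀ = 1)
    (hQU : Q * U * Qᵀ = Matrix.diagonal lam) (hr : ∀ i, |lam i| ≤ r) (l m : Fin n) :
    |U l m| ≤ n * r := by
  have h : U = Qᵀ * Matrix.diagonal lam * Q := by
    have hQ' := mul_eq_one_comm.1 hQ
    rw [← hQU]
    calc U = (Qᵀ * Q) * U * (Qᵀ * Q) := by simp [hQ']
      _ = _ := by simp only [Matrix.mul_assoc]
  have h' : U l m = ∑ i, (Q i l * Q i m) * lam i := by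
    rw [h, Matrix.mul_apply]
    refine Finset.sum_congr rfl fun i _ => ?_
    rw [Matrix.mul_diagonal, Matrix.transpose_apply]
    ring
  rw [h']
  refine (abs_sum_mul_le zero_le_one (fun i => ?_) hr).trans (by rw [one_mul])
  rw [abs_mul]
  exact mul_le_one₀ (abs_frame_le hQ _ _) (abs_nonneg _) (abs_frame_le hQ _ _)

/-- The Hessian in terms of `Umat`. -/
lemma dd_dd_eq_Umat_sub {u : (Fin n → ℝ) → ℝ → ℝ} {g : (Fin n → ℝ) × ℝ → ℝ}
    (hgu : g = fun q => u q.1 q.2) (hg : ContDiff ℝ 2 g) (q : (Fin n → ℝ) × ℝ) (l m : Fin n) :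
    dd (spat (Pi.single l 1)) (dd (spat (Pi.single m 1)) g) q =
      Umat A u q.1 q.2 l m - A q.1 q.2 (xgrad g q) l m := by
  subst hgu
  rw [Umat, Matrix.add_apply, shess_eq _ _ hg, sgrad_eq_xgrad _ _
    ((hg.differentiable (by norm_num)) _)]
  ring

lemma xgrad_dd_frame {u : (Fin n → ℝ) → ℝ → ℝ} {g : (Fin n → ℝ) × ℝ → ℝ}
    (hgu : g = fun q => u q.1 q.2) (hg : ContDiff ℝ 2 g) (hQ : Q * Qᵀ = 1)
    {q : (Fin n → ℝ) × ℝ} {lam : Fin n → ℝ}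
    (hQU : Q * Umat A u q.1 q.2 * Qᵀ = Matrix.diagonal lam) (i l : Fin n) :
    xgrad (dd (spat (Q i)) g) q l = lam i * Q i l - ∑ m, A q.1 q.2 (xgrad g q) l m * Q i m := by
  rw [← frame_mul_eq hQ hQU i l, ← Finset.sum_sub_distrib, xgrad, dd_comm hg, dd_spat]
  refine Finset.sum_congr rfl fun m _ => ?_
  rw [xgrad, dd_comm hg, dd_dd_eq_Umat_sub (A := A) hgu hg]
  ring

lemma fderiv_sum_smul {X E : Type*} [NormedAddCommGroup X] [NormedSpace ℝ X]
    [NormedAddCommGroup E] [NormedSpace ℝ E] {a : Fin n → Fin n → X → E}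
    (hd : ∀ l m, Differentiable ℝ (a l m)) (k : Fin n → Fin n → ℝ) :
    fderiv ℝ (fun y => ∑ l, ∑ m, k l m • a l m y) =
      fun y => ∑ l, ∑ m, k l m • fderiv ℝ (a l m) y :=
  funext fun y => (HasFDerivAt.fun_sum fun l _ => HasFDerivAt.fun_sum fun m _ =>
    ((hd l m y).hasFDerivAt.const_smul (k l m))).fderiv

lemma norm_frame_sum_le {E : Type*} [NormedAddCommGroup E] [NormedSpace ℝ E] (hQ : Q * Qᵀ = 1)
    (j k : Fin n) {b : Fin n → Fin n → E} {c : ℝ} (hb : ∀ l m, ‖b l m‖ ≤ c) :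
    ‖∑ l, ∑ m, (Q j l * Q k m) • b l m‖ ≤ n ^ 2 * c := by
  have hq : ∀ l m, ‖Q j l * Q k m‖ ≤ 1 := fun l m => by
    rw [Real.norm_eq_abs, abs_mul]
    exact mul_le_one₀ (abs_frame_le hQ _ _) (abs_nonneg _) (abs_frame_le hQ _ _)
  calc _ ≤ ∑ _l : Fin n, ∑ _m : Fin n, c :=
        norm_sum_le_of_le _ fun l _ => norm_sum_le_of_le _ fun m _ => by
          rw [norm_smul]
          exact (mul_le_of_le_one_left (norm_nonneg _) (hq l m)).trans (hb l m)
    _ = _ := by simp; ring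

/-- The entries of `A` as functions of a single variable. -/
def entryFun (A : (Fin n → ℝ) → ℝ → (Fin n → ℝ) → Mat n) (l m : Fin n) :
    ((Fin n → ℝ) × ℝ) × (Fin n → ℝ) → ℝ :=
  fun y => A y.1.1 y.1.2 y.2 l m

lemma frameEntry_eq_sum (A : (Fin n → ℝ) → ℝ → (Fin n → ℝ) → Mat n) (Q : Mat n) (j k : Fin n) :
    frameEntry A Q j k = fun y => ∑ l, ∑ m, (Q j l * Q k m) • entryFun A l m y := by
  funext y
  simp only [frameEntry, frame_apply, smul_eq_mul, entryFun]
  exact Finset.sum_congr rfl fun l _ => Finset.sum_congr rfl fun m _ => by ring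

lemma norm_fderiv_frame_sum_le {X E : Type*} [NormedAddCommGroup X] [NormedSpace ℝ X]
    [NormedAddCommGroup E] [NormedSpace ℝ E] (hQ : Q * Qᵀ = 1) (j k : Fin n)
    {a : Fin n → Fin n → X → E} (hd : ∀ l m, Differentiable ℝ (a l m)) {c : ℝ} {y : X}
    (h1 : ∀ l m, ‖fderiv ℝ (a l m) y‖ ≤ c) :
    ‖fderiv ℝ (fun y => ∑ l, ∑ m, (Q j l * Q k m) • a l m y) y‖ ≤ n ^ 2 * c := by
  rw [fderiv_sum_smul hd fun l m => Q j l * Q k m]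
  exact norm_frame_sum_le hQ j k h1

lemma norm_fderiv_frameEntry_le (hA : ASmooth A) (hQ : Q * Qᵀ = 1) {c : ℝ}
    {y : ((Fin n → ℝ) × ℝ) × (Fin n → ℝ)} (h1 : ∀ l m, ‖fderiv ℝ (entryFun A l m) y‖ ≤ c)
    (h2 : ∀ l m, ‖fderiv ℝ (fderiv ℝ (entryFun A l m)) y‖ ≤ c) (j k : Fin n) :
    ‖fderiv ℝ (frameEntry A Q j k) y‖ ≤ n ^ 2 * c ∧
      ‖fderiv ℝ (fderiv ℝ (frameEntry A Q j k)) y‖ ≤ n ^ 2 * c := by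
  have hs : ∀ l m, ContDiff ℝ 2 (entryFun A l m) := fun l m => contDiff_infty.1 (hA.2 l m) 2
  have hd : ∀ l m, Differentiable ℝ (entryFun A l m) := fun l m =>
    (hs l m).differentiable (by norm_num)
  have hd2 : ∀ l m, Differentiable ℝ (fderiv ℝ (entryFun A l m)) := fun l m =>
    ((hs l m).fderiv_right (m := 1) (by norm_num)).differentiable (by norm_num)
  rw [frameEntry_eq_sum]
  refine ⟨norm_fderiv_frame_sum_le hQ j k hd h1, ?_⟩
  rw [fderiv_sum_smul hd fun l m => Q j l * Q k m]
  exact norm_fderiv_frame_sum_le hQ j k hd2 h2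

end Frames

/-! ### The interior estimate -/

section InteriorEstimate

variable {n : ℕ} {Ω : Set (Fin n → ℝ)} {T : ℝ} {Γ : Set (Fin n → ℝ)} {f : (Fin n → ℝ) → ℝ}
  {A : (Fin n → ℝ) → ℝ → (Fin n → ℝ) → Mat n} {ψ : (Fin n → ℝ) → ℝ → ℝ → (Fin n → ℝ) → ℝ}
  {u ub : (Fin n → ℝ) → ℝ → ℝ} {g gb : (Fin n → ℝ) × ℝ → ℝ} {Q : Mat n}

lemma dd_comm_four {X : Type*} [NormedAddCommGroup X] [NormedSpace ℝ X] {g : X → ℝ}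
    (hg : ContDiff ℝ ((4 : ℕ) : ℕ∞) g) (v w : X) :
    dd v (dd v (dd w (dd w g))) = dd w (dd w (dd v (dd v g))) := by
  have h2 : ContDiff ℝ 2 g := contDiff_two_of_nat (by norm_num) hg
  have h3 : ∀ v, ContDiff ℝ 2 (dd v g) := fun v =>
    contDiff_two_of_nat (k := 3) (by norm_num) (dd_contDiff hg v)
  have h4 : ∀ v w, ContDiff ℝ 2 (dd v (dd w g)) := fun v w =>
    contDiff_two_of_nat (k := 2) le_rfl (dd_contDiff (k := 2) (dd_contDiff (k := 3) hg w) v)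
  rw [dd_comm (h3 w) v w, dd_comm (h4 v w) v w, dd_comm h2 v w, dd_comm (h3 v) v w]

lemma dd_comm_three {X : Type*} [NormedAddCommGroup X] [NormedSpace ℝ X] {g : X → ℝ}
    (hg : ContDiff ℝ ((4 : ℕ) : ℕ∞) g) (v w : X) :
    dd v (dd w (dd w g)) = dd w (dd w (dd v g)) := by
  have h2 : ContDiff ℝ 2 g := contDiff_two_of_nat (by norm_num) hg
  have h3 : ∀ v, ContDiff ℝ 2 (dd v g) := fun v =>
    contDiff_two_of_nat (k := 3) (by norm_num) (dd_contDiff hg v)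
  rw [dd_comm (h3 w) v w, dd_comm h2 v w]

lemma abs_xgrad_dd_frame_le (hgu : g = fun q => u q.1 q.2) (hg : ContDiff ℝ 2 g) (hQ : Q * Qᵀ = 1)
    {q : (Fin n → ℝ) × ℝ} {lam : Fin n → ℝ}
    (hQU : Q * Umat A u q.1 q.2 * Qᵀ = Matrix.diagonal lam) {c : ℝ}
    (hA0 : ∀ l m, |A q.1 q.2 (xgrad g q) l m| ≤ c) (i : Fin n) :
    (∀ l, |xgrad (dd (spat (Q i)) g) q l| ≤ |lam i| + n * c) ∧
      lam i ^ 2 / 2 - n * (n * c) ^ 2 ≤ ∑ l, xgrad (dd (spat (Q i)) g) q l ^ 2 := by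
  have hβ : ∀ l, |∑ m, A q.1 q.2 (xgrad g q) l m * Q i m| ≤ n * c := fun l => by
    have := abs_sum_mul_le ((abs_nonneg _).trans (hA0 l l)) (hA0 l) (abs_frame_le hQ i)
    rwa [mul_one] at this
  simp only [xgrad_dd_frame hgu hg hQ hQU]
  constructor
  · intro l
    refine (abs_sub _ _).trans (add_le_add ?_ (hβ l))
    rw [abs_mul]
    exact mul_le_of_le_one_right (abs_nonneg _) (abs_frame_le hQ i l)
  · have h : ∀ l, lam i ^ 2 / 2 * Q i l ^ 2 - (n * c) ^ 2 ≤
        (lam i * Q i l - ∑ m, A q.1 q.2 (xgrad g q) l m * Q i m) ^ 2 := fun l => by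
      have h1 := sq_le_sq' (abs_le.1 (hβ l)).1 (abs_le.1 (hβ l)).2
      nlinarith [sq_nonneg (lam i * Q i l - 2 * ∑ m, A q.1 q.2 (xgrad g q) l m * Q i m)]
    have h2 := Finset.sum_le_sum fun l (_ : l ∈ Finset.univ) => h l
    rw [Finset.sum_sub_distrib, ← Finset.mul_sum, frame_row_sq hQ] at h2
    simpa using h2

lemma abs_hess_le (hgu : g = fun q => u q.1 q.2) (hg : ContDiff ℝ 2 g) (hQ : Q * Qᵀ = 1)
    {q : (Fin n → ℝ) × ℝ} {lam : Fin n → ℝ}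
    (hQU : Q * Umat A u q.1 q.2 * Qᵀ = Matrix.diagonal lam) {c r : ℝ}
    (hA0 : ∀ l m, |A q.1 q.2 (xgrad g q) l m| ≤ c) (hr : ∀ i, |lam i| ≤ r) (l m : Fin n) :
    |xgrad (dd (spat (Pi.single l 1)) g) q m| ≤ n * r + c := by
  rw [xgrad, dd_dd_eq_Umat_sub (A := A) hgu hg]
  exact (abs_sub _ _).trans (add_le_add (abs_entry_le hQ hQU hr _ _) (hA0 _ _))

lemma const_bounds {m c : ℝ} (hm : 1 ≤ m) (hc : 1 ≤ c) {a b : ℕ} (ha : a ≤ 3) (hb : b ≤ 2) :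
    m ^ a * c ^ b ≤ m ^ 3 * c ^ 2 :=
  mul_le_mul (pow_le_pow_right₀ hm ha) (pow_le_pow_right₀ hc hb) (by positivity) (by positivity)

lemma abs_le_mul_of_sum_pos {lam : Fin n → ℝ} {i₀ : Fin n} (hs : 0 < ∑ i, lam i)
    (htop : ∀ i, lam i ≤ lam i₀) (i : Fin n) : |lam i| ≤ n * lam i₀ := by
  have h1 : ∑ j, lam j ≤ n * lam i₀ :=
    (Finset.sum_le_sum fun j _ => htop j).trans (by simp)
  have hn : (0 : ℝ) < n := by
    have := i₀.pos
    exact_mod_cast this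
  have hn1 : (1 : ℝ) ≤ n := by
    have := i₀.pos
    exact_mod_cast this
  have h0 : 0 < lam i₀ := by
    by_contra! h
    nlinarith
  rw [abs_le]
  constructor
  · have h2 : ∑ j ∈ Finset.univ.erase i, lam j ≤ ∑ j ∈ Finset.univ.erase i, lam i₀ :=
      Finset.sum_le_sum fun j _ => htop j
    have h3 := Finset.add_sum_erase Finset.univ lam (Finset.mem_univ i)
    have h4 := Finset.add_sum_erase Finset.univ (fun _ => lam i₀) (Finset.mem_univ i)
    simp only [Finset.sum_const, Finset.card_univ, Fintype.card_fin, nsmul_eq_mul] at h4 h2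
    linarith
  · nlinarith [htop i]

set_option maxHeartbeats 1600000 in
lemma interior_estimate (hn : 0 < n) (hΓ : GoodCone Γ) (hfs : SmoothSymF Γ f) (hf1 : F1cond Γ f)
    (hf2 : F2cond Γ f) (hf5 : F5cond Γ f) (hA : ASmooth A) (hψ : PsiSmooth ψ) (hA2 : A2cond A ψ)
    (hΩ : IsOpen Ω) (hgu : g = fun q => u q.1 q.2) (hg : ContDiff ℝ ((4 : ℕ) : ℕ∞) g)
    (hgbu : gb = fun q => ub q.1 q.2) (hgb : ContDiff ℝ 2 gb)
    (hadm : Admissible Γ A u (QTbar Ω T)) (hE : SolvesE f A ψ u (QT Ω T))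
    {q : (Fin n → ℝ) × ℝ} (hq : q ∈ QT Ω T) (hQ : Q * Qᵀ = 1) {lam : Fin n → ℝ}
    (hlam : lam = eigenVec (Umat A u q.1 q.2))
    (hQU : Q * Umat A u q.1 q.2 * Qᵀ = Matrix.diagonal lam) {i₀ : Fin n}
    (htop : ∀ i, lam i ≤ lam i₀) {c θ δ N M Λ C : ℝ} (hc : 1 ≤ c) (hC : C = 6 * n ^ 3 * c ^ 2)
    (hδ : 0 < δ) (hδ1 : δ ≤ 1) (hN : 0 ≤ N) (hΛ1 : 1 ≤ Λ)
    (hΛ : ∀ (i₀ : Fin n) (F lam η V d : Fin n → ℝ), (∀ i, 0 < F i) →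
        (∀ i, |lam i| ≤ n * lam i₀) →
        (∀ i, |η i| ≤ 12 * C ^ 3 * (δ * (|lam i| + 1) + N)) →
        (∀ k, V k + d k = -(lam i₀ * η k)) → (∀ k, |d k| ≤ 12 * C ^ 3 * lam i₀) →
        (∀ b : Fin n → ℝ, b i₀ = 0 →
          lam i₀ * (δ / 2 * (∑ i, F i * lam i ^ 2) + N * θ * (∑ i, F i) -
              12 * C ^ 3 * (1 + ∑ i, F i) - 12 * C ^ 3 * N + M - ∑ i, F i * η i ^ 2)
            - 12 * C ^ 3 * (1 + ∑ i, F i) * lam i₀ - 12 * C ^ 3 * (∑ i, F i * lam i ^ 2)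
            - ∑ k, (4 * ((F k - F i₀) * (b k * V k)) +
                2 * (b k ^ 2 * ((F k - F i₀) * (lam i₀ - lam k)))) ≤ 0) →
        lam i₀ ≤ Λ)
    (hmax : ∀ q' ∈ QTbar Ω T,
      (Q * Umat A u q'.1 q'.2 * Qᵀ) i₀ i₀ * Real.exp (exponent δ N M g gb q') ≤
        (Q * Umat A u q.1 q.2 * Qᵀ) i₀ i₀ * Real.exp (exponent δ N M g gb q))
    (hA0 : ∀ l m, |A q.1 q.2 (xgrad g q) l m| ≤ c)
    (hA1 : ∀ j k, ‖fderiv ℝ (frameEntry A Q j k) (q, xgrad g q)‖ ≤ c)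
    (hA2' : ∀ j k, ‖fderiv ℝ (fderiv ℝ (frameEntry A Q j k)) (q, xgrad g q)‖ ≤ c)
    (hψ0 : |psiFun ψ (q, (g q, xgrad g q))| ≤ c)
    (hψ1 : ‖fderiv ℝ (psiFun ψ) (q, (g q, xgrad g q))‖ ≤ c)
    (hψ2 : ‖fderiv ℝ (fderiv ℝ (psiFun ψ)) (q, (g q, xgrad g q))‖ ≤ c)
    (hp : ∀ l, |xgrad g q l| ≤ c) (hpb : ∀ l, |xgrad gb q l| ≤ c)
    (hgbt : |dd timeVec gb q| ≤ c)
    (hsub : (fun i => frameDiag Q (Umat A ub q.1 q.2) i - θ) ∈ Γ) :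
    lam i₀ ≤ Λ := by
  by_cases hL1 : lam i₀ ≤ 1
  · exact hL1.trans hΛ1
  have hL : 1 ≤ lam i₀ := (not_le.1 hL1).le
  have hn1 : (1 : ℝ) ≤ n := by exact_mod_cast hn
  have hc0 : 0 ≤ c := by linarith
  have B := fun (a b : ℕ) (ha : a ≤ 3) (hb : b ≤ 2) => const_bounds (a := a) (b := b) hn1 hc ha hb
  have B00 := B 0 0 (by norm_num) (by norm_num)
  have B01 := B 0 1 (by norm_num) (by norm_num)
  have B02 := B 0 2 (by norm_num) (by norm_num)
  have B11 := B 1 1 (by norm_num) (by norm_num)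
  have B12 := B 1 2 (by norm_num) (by norm_num)
  have B21 := B 2 1 (by norm_num) (by norm_num)
  have B22 := B 2 2 (by norm_num) (by norm_num)
  norm_num only [pow_zero, pow_one, one_mul, mul_one] at B00 B01 B02 B11 B12 B21 B22
  have hC1 : 1 ≤ C := by linarith
  have hC0 : 0 ≤ C := by linarith
  have hcC : c ≤ C := by linarith
  have hncC : n * c ≤ C := by linarith
  have hC3 : C ≤ C ^ 3 := by simpa using pow_le_pow_right₀ hC1 (show 1 ≤ 3 by norm_num)
  have hC23 : C ^ 2 ≤ C ^ 3 := pow_le_pow_right₀ hC1 (by norm_num)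
  have h2 : ContDiff ℝ 2 g := contDiff_two_of_nat (by norm_num) hg
  have hη2 := exponent_contDiff (δ := δ) (N := N) (M := M) hg hgb
  have hlamΓ : lam ∈ Γ := hlam ▸ hadm q (QT_subset_QTbar hq)
  have hF : ∀ i, 0 < fLam f lam i := fun i => hf1 lam hlamΓ i
  have hS0 : 0 ≤ ∑ i, fLam f lam i := Finset.sum_nonneg fun i _ => (hF i).le
  have hlamn := abs_le_mul_of_sum_pos (sum_pos_of_mem hn hΓ hlamΓ) htop
  have hdiag : ∀ i, (Q * Umat A u q.1 q.2 * Qᵀ) i i = lam i := fun i => by simp [hQU]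
  have hframe : ∀ i, dd (spat (Q i)) (dd (spat (Q i)) g) q + frameEntry A Q i i (q, xgrad g q) =
      lam i := fun i => by
    rw [← hdiag i, frame_Umat (hgu ▸ h2), hgu]
  obtain ⟨F3, F4, F5⟩ := maximum_conditions hA hΩ hgu hg hq hη2 (hdiag i₀) hmax
  have hF1 := fun ξ : Fin n → ℝ => (differentiated_equation hΓ hfs hf2 hA hψ hΩ hgu hg hadm hE hq
    hQ hlam hQU (i₀ := i₀) (b := 0) rfl (ξ := ξ) rfl).1
  have hh := abs_xgrad_dd_frame_le hgu h2 hQ hQU hA0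
  have hH := abs_hess_le hgu h2 hQ hQU hA0 hlamn
  have hQ1 : ∀ i, ‖spat (Q i)‖ ≤ 1 := fun i => norm_spat_le zero_le_one (abs_frame_le hQ i)
  have hsingle : ∀ l, ‖spat (Pi.single l (1 : ℝ) : Fin n → ℝ)‖ ≤ 1 := fun l =>
    norm_spat_le zero_le_one fun m => by
      by_cases h : m = l
      · subst h; simp
      · simp [h]
  have hhn : ∀ i, ‖xgrad (dd (spat (Q i)) g) q‖ ≤ |lam i| + n * c := fun i =>
    (pi_norm_le_iff_of_nonneg (by positivity)).2 (hh i).1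
  have hyi : ∀ i, ‖(spat (Q i), xgrad (dd (spat (Q i)) g) q)‖ ≤ |lam i| + 1 + n * c := fun i =>
    norm_prodMk_le
      ((hQ1 i).trans
        (by nlinarith [abs_nonneg (lam i), mul_nonneg (by linarith : (0 : ℝ) ≤ n) hc0]))
      ((hhn i).trans (by linarith))
  have hyC : ∀ i, ‖(spat (Q i), xgrad (dd (spat (Q i)) g) q)‖ ≤ C * (|lam i| + 1) := fun i =>
    (hyi i).trans (by nlinarith [abs_nonneg (lam i)])
  have hHn : ∀ l, ‖xgrad (dd (spat (Pi.single l 1)) g) q‖ ≤ n * (n * lam i₀) + c := fun l =>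
    (pi_norm_le_iff_of_nonneg (by positivity)).2 (hH l)
  set F := fLam f lam with hFdef
  set η := exponent δ N M g gb with hη
  have hnn : (0 : ℝ) ≤ n * c := by positivity
  have hpnorm : ‖xgrad g q‖ ≤ c := (pi_norm_le_iff_of_nonneg hc0).2 hp
  have hpbnorm : ‖xgrad gb q‖ ≤ c := (pi_norm_le_iff_of_nonneg hc0).2 hpb
  have hg1 : ∀ i, |dd (spat (Q i)) g q| ≤ n * c := fun i => by
    rw [dd_spat]
    simpa using abs_sum_mul_le zero_le_one (abs_frame_le hQ i) hp
  have hgb1 : ∀ i, |dd (spat (Q i)) gb q| ≤ n * c := fun i => by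
    rw [dd_spat]
    simpa using abs_sum_mul_le zero_le_one (abs_frame_le hQ i) hpb
  have hηb : ∀ i, |dd (spat (Q i)) η q| ≤ 12 * C ^ 3 * (δ * (|lam i| + 1) + N) := fun i => by
    have e : dd (spat (Q i)) η q = δ * ∑ l, xgrad g q l * xgrad (dd (spat (Q i)) g) q l +
        N * (dd (spat (Q i)) gb q - dd (spat (Q i)) g q) := by
      rw [(dd_exponent hg hgb q _).1]; simp [spat]
    have h1 := abs_sum_mul_le hc0 hp (hh i).1
    have h3 : |dd (spat (Q i)) gb q - dd (spat (Q i)) g q| ≤ 2 * C :=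
      (abs_sub _ _).trans (by linarith [hg1 i, hgb1 i])
    have h4 : n * (c * (|lam i| + n * c)) ≤ C * (|lam i| + 1) := by
      nlinarith [abs_nonneg (lam i)]
    rw [e]
    calc _ ≤ δ * (C * (|lam i| + 1)) + N * (2 * C) := by
          refine (abs_add_le _ _).trans (add_le_add ?_ ?_)
          · rw [abs_mul, abs_of_pos hδ]
            exact mul_le_mul_of_nonneg_left (h1.trans h4) hδ.le
          · rw [abs_mul, abs_of_nonneg hN]
            exact mul_le_mul_of_nonneg_left h3 hN
      _ = C * (δ * (|lam i| + 1)) + 2 * C * N := by ring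
      _ ≤ 12 * C ^ 3 * (δ * (|lam i| + 1)) + 12 * C ^ 3 * N := by
          have : 0 ≤ δ * (|lam i| + 1) := by positivity
          gcongr <;> linarith
      _ = _ := by ring
  have hLn : ∀ i, |lam i| + 1 + n * c ≤ n * lam i₀ + lam i₀ + n * c * lam i₀ := fun i => by
    have h1 := hlamn i
    have h3 : n * c ≤ n * c * lam i₀ := le_mul_of_one_le_right hnn hL
    linarith
  have hcL : c * (n * lam i₀ + lam i₀ + n * c * lam i₀) ≤ C / 2 * lam i₀ := by
    have : c * (n * lam i₀ + lam i₀ + n * c * lam i₀) =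
      (n * c + c + n * c ^ 2) * lam i₀ := by ring
    rw [this]
    exact mul_le_mul_of_nonneg_right (by linarith) (by linarith)
  have hCL : C * lam i₀ ≤ 12 * C ^ 3 * lam i₀ :=
    mul_le_mul_of_nonneg_right (by linarith) (by linarith)
  have hDa : ∀ j k i, |fderiv ℝ (frameEntry A Q j k) (q, xgrad g q)
      (spat (Q i), xgrad (dd (spat (Q i)) g) q)| ≤ C / 2 * lam i₀ := fun j k i =>
    (clm_abs_le (hA1 j k) ((hyi i).trans (hLn i))).trans hcL
  have hτ : ‖(timeVec : (Fin n → ℝ) × ℝ)‖ ≤ 1 := norm_prodMk_le (by simp) (by simp)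
  have ha0 : |frameEntry A Q i₀ i₀ (q, xgrad g q)| ≤ n ^ 2 * c := by
    rw [frameEntry_eq_sum]
    exact norm_frame_sum_le (b := fun l m => A q.1 q.2 (xgrad g q) l m) hQ i₀ i₀ hA0
  have hHL : n * (n * lam i₀) + c ≤ (n ^ 2 + c) * lam i₀ := by nlinarith
  have hα : ∀ l j k, |fderiv ℝ (frameEntry A Q j k) (q, xgrad g q)
      (spat (Pi.single l 1), xgrad (dd (spat (Pi.single l 1)) g) q)| ≤
        c * ((n ^ 2 + c) * lam i₀) := fun l j k => by
    refine clm_abs_le (hA1 j k) (norm_prodMk_le ((hsingle l).trans ?_) ((hHn l).trans hHL))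
    nlinarith [sq_nonneg (n : ℝ)]
  have hρψ : ∀ l, |fderiv ℝ (psiFun ψ) (q, (g q, xgrad g q)) (spat (Pi.single l 1),
      (dd (spat (Pi.single l 1)) g q, xgrad (dd (spat (Pi.single l 1)) g) q))| ≤
        c * ((n ^ 2 + c) * lam i₀) := fun l => by
    refine clm_abs_le hψ1 (norm_prodMk_le ((hsingle l).trans ?_)
      (norm_prodMk_le ((hp l).trans ?_) ((hHn l).trans hHL))) <;>
    nlinarith [sq_nonneg (n : ℝ)]
  have hcCL : c * ((n ^ 2 + c) * lam i₀) ≤ C * lam i₀ := by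
    have : c * ((n ^ 2 + c) * lam i₀) = (n ^ 2 * c + c ^ 2) * lam i₀ := by ring
    rw [this]
    exact mul_le_mul_of_nonneg_right (by linarith) (by linarith)
  have hlower := linearized_exponent_lower (c := C) (M := M) (θ := θ) (P := spat (xgrad g q))
    (p := xgrad g q) (pb := xgrad gb q) (hp := xgrad (dd (spat (xgrad g q)) g) q)
    (dut := xgrad (dd timeVec g) q) (Dη := xgrad η q) (et := dd timeVec η q)
    (gt := dd timeVec g q) (gbt := dd timeVec gb q) (ψ0 := psiFun ψ (q, (g q, xgrad g q)))
    (da := fun i => fderiv ℝ (frameEntry A Q i i) (q, xgrad g q))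
    (dψ := fderiv ℝ (psiFun ψ) (q, (g q, xgrad g q))) (F := F) (lam := lam)
    (e2 := fun i => dd (spat (Q i)) (dd (spat (Q i)) η) q)
    (gii := fun i => dd (spat (Q i)) (dd (spat (Q i)) g) q)
    (gbii := fun i => dd (spat (Q i)) (dd (spat (Q i)) gb) q)
    (ai := fun i => frameEntry A Q i i (q, xgrad g q))
    (abi := fun i => frameEntry A Q i i (q, xgrad gb q))
    (h := fun i => xgrad (dd (spat (Q i)) g) q)
    (w := fun i => xgrad (dd (spat (Q i)) (dd (spat (Q i)) g)) q)
    hC1 hδ hδ1 hN (fun i => (hA1 i i).trans hcC) (hψ1.trans hcC) hF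
    ((norm_spat_le hc0 hp).trans hcC)
    ((abs_sum_mul_le hc0 hp hp).trans (by nlinarith))
    ((norm_sub_le _ _).trans (by linarith))
    (fun i => le_trans (by nlinarith) (hh i).2)
    (fun i => (dd_exponent hg hgb q _).2)
    (by rw [(dd_exponent hg hgb q _).1]; simp [timeVec])
    (by
      funext l
      have e := (dd_exponent (δ := δ) (N := N) (M := M) hg hgb q (spat (Pi.single l 1))).1
      have e' : xgrad (dd (spat (xgrad g q)) g) q l =
          ∑ m, xgrad g q m * xgrad (dd (spat (Pi.single l 1)) g) q m := by
        rw [xgrad, dd_comm h2, dd_spat]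
      simp only [Pi.add_apply, Pi.smul_apply, Pi.sub_apply, smul_eq_mul, e']
      rwa [show (spat (Pi.single l (1 : ℝ)) : (Fin n → ℝ) × ℝ).2 = 0 from rfl, mul_zero,
        sub_zero] at e)
    (by
      have h := hF1 (xgrad g q)
      rw [dd_spat (dd timeVec g), dd_spat g] at h
      simpa only [dd_spat (dd (spat (Q _)) (dd (spat (Q _)) g)) (xgrad g q)] using h)
    hframe
    (fun i => by
      have := (frameEntry_concave hA hA2 Q i q (xgrad g q) (xgrad gb q - xgrad g q)).1
      simpa using this)
    (by
      have h := sum_fLam_mul_nonneg hΓ hfs hf2 hf5 hlamΓ hsub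
      refine h.trans_eq (Finset.sum_congr rfl fun i _ => ?_)
      rw [frameDiag, frame_Umat (hgbu ▸ hgb), ← hgbu])
    (by
      refine (sum_fLam_mul_self_le hΓ hfs hf2 hf5 hlamΓ).trans_eq ?_
      have hd := h2.differentiable (by norm_num)
      have := hE q hq
      rw [deriv_time _ _ (hgu ▸ hd _), sgrad_eq_xgrad _ _ (hgu ▸ hd _), ← hgu, ← hlam] at this
      rw [sub_eq_iff_eq_add'] at this
      rw [this, hgu]; rfl)
    (hψ0.trans hcC) (hgbt.trans hcC)
  refine hΛ i₀ F lam (fun k => dd (spat (Q k)) η q)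
    (fun k => dd (spat (Q i₀)) (dd (spat (Q i₀)) (dd (spat (Q k)) g)) q +
      fderiv ℝ (frameEntry A Q i₀ k) (q, xgrad g q)
        (spat (Q i₀), xgrad (dd (spat (Q i₀)) g) q))
    (fun k => fderiv ℝ (frameEntry A Q i₀ i₀) (q, xgrad g q)
        (spat (Q k), xgrad (dd (spat (Q k)) g) q) - fderiv ℝ (frameEntry A Q i₀ k) (q, xgrad g q)
        (spat (Q i₀), xgrad (dd (spat (Q i₀)) g) q)) hF hlamn hηb (fun k => ?_) (fun k => ?_)
    fun b hb => ?_
  · rw [← F3 (Q k), dd_comm_three hg (spat (Q k))]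
    ring
  · exact (abs_sub _ _).trans (by linarith [hDa i₀ i₀ k, hDa i₀ k i₀])
  have F2 := (differentiated_equation hΓ hfs hf2 hA hψ hΩ hgu hg hadm hE hq hQ hlam hQU hb
    (ξ := Q i₀) rfl).2
  have hcomb := combined_inequality (c := C) (L := lam i₀) (F := F) (lam := lam)
    (a1 := fderiv ℝ (frameEntry A Q i₀ i₀) (q, xgrad g q))
    (a2 := fderiv ℝ (fderiv ℝ (frameEntry A Q i₀ i₀)) (q, xgrad g q))
    (da := fun i => fderiv ℝ (frameEntry A Q i i) (q, xgrad g q))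
    (d2a := fun i => fderiv ℝ (fderiv ℝ (frameEntry A Q i i)) (q, xgrad g q))
    (dψ := fderiv ℝ (psiFun ψ) (q, (g q, xgrad g q)))
    (d2ψ := fderiv ℝ (fderiv ℝ (psiFun ψ)) (q, (g q, xgrad g q)))
    (y := fun i => (spat (Q i), xgrad (dd (spat (Q i)) g) q))
    (w := fun i => xgrad (dd (spat (Q i)) (dd (spat (Q i)) g)) q)
    (e1 := fun i => dd (spat (Q i)) η q) (e2 := fun i => dd (spat (Q i)) (dd (spat (Q i)) η) q)
    (τ := timeVec) (et := dd timeVec η q) (dut := xgrad (dd timeVec g) q) (Dη := xgrad η q)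
    (α := fun l => fderiv ℝ (frameEntry A Q i₀ i₀) (q, xgrad g q)
      (spat (Pi.single l 1), xgrad (dd (spat (Pi.single l 1)) g) q))
    (ρ := fun l => fderiv ℝ (psiFun ψ) (q, (g q, xgrad g q)) (spat (Pi.single l 1),
      (dd (spat (Pi.single l 1)) g q, xgrad (dd (spat (Pi.single l 1)) g) q)) -
      ∑ i, F i * fderiv ℝ (frameEntry A Q i i) (q, xgrad g q)
        (spat (Pi.single l 1), xgrad (dd (spat (Pi.single l 1)) g) q))
    hC1 hL ((hA1 _ _).trans hcC) ((hA2' _ _).trans hcC) (fun i => (hA1 _ _).trans hcC)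
    (fun i => (hA2' _ _).trans hcC) (hψ1.trans hcC) (hψ2.trans hcC)
    (fun i π => (frameEntry_concave hA hA2 Q i q (xgrad g q) π).2)
    (fun π => psiFun_convex hψ hA2 q (g q) (xgrad g q) π)
    hF hyC (hQ1 i₀) hτ ((hhn i₀).trans ?_) ((hg1 i₀).trans hncC) ?_ F2 (fun i => ?_) ?_ ?_ ?_ ?_ ?_
  · have h4 : 4 * C ^ 2 ≤ 12 * C ^ 3 := by nlinarith
    have h5 : 4 * C ^ 2 * (1 + ∑ i, F i) ≤ 12 * C ^ 3 * (1 + ∑ i, F i) :=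
      mul_le_mul_of_nonneg_right h4 (by linarith)
    have h6 : 4 * C ^ 2 * N ≤ 12 * C ^ 3 * N := mul_le_mul_of_nonneg_right h4 hN
    have h7 := mul_le_mul_of_nonneg_left (hlower) (by linarith : 0 ≤ lam i₀)
    have h8 := mul_le_mul_of_nonneg_left (add_le_add h5 h6) (by linarith : 0 ≤ lam i₀)
    linarith
  · have h1 : |lam i₀| = lam i₀ := abs_of_nonneg (by linarith)
    rw [h1]
    nlinarith
  · have h1 : dd (spat (Q i₀)) (dd (spat (Q i₀)) g) q =
        lam i₀ - frameEntry A Q i₀ i₀ (q, xgrad g q) := by linarith [hframe i₀]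
    rw [h1]
    refine (abs_sub _ _).trans ?_
    rw [abs_of_nonneg (by linarith : 0 ≤ lam i₀)]
    nlinarith
  · have := F4 (Q i)
    rw [dd_comm_four hg (spat (Q i))] at this
    exact this
  · rw [← dd_comm_three hg timeVec]
    exact F5
  · funext l
    have h := hF1 (Pi.single l 1)
    simp only [mul_add, Finset.sum_add_distrib] at h
    simp only [Finset.sum_apply, Pi.smul_apply, smul_eq_mul, Pi.add_apply]
    simp only [xgrad] at h ⊢
    linarith
  · refine (pi_norm_le_iff_of_nonneg (by positivity)).2 fun l => (abs_sub _ _).trans ?_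
    have h1 : |∑ i, F i * fderiv ℝ (frameEntry A Q i i) (q, xgrad g q)
        (spat (Pi.single l 1), xgrad (dd (spat (Pi.single l 1)) g) q)| ≤
        (∑ i, F i) * (C * lam i₀) := by
      refine (Finset.abs_sum_le_sum_abs _ _).trans ?_
      rw [Finset.sum_mul]
      refine Finset.sum_le_sum fun i _ => ?_
      rw [abs_mul, abs_of_pos (hF i)]
      exact mul_le_mul_of_nonneg_left ((hα l i i).trans hcCL) (hF i).le
    linarith [(hρψ l).trans hcCL]
  · funext l
    have h := F3 (Pi.single l 1)
    simp only [Pi.sub_apply, Pi.neg_apply, Pi.smul_apply, smul_eq_mul]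
    simp only [xgrad] at h ⊢
    linarith
  · exact (pi_norm_le_iff_of_nonneg (by positivity)).2 fun l => (hα l i₀ i₀).trans hcCL

end InteriorEstimate

/-! ### Uniform constants -/

section UniformConstants

variable {n : ℕ} {Ω : Set (Fin n → ℝ)} {T : ℝ} {Γ : Set (Fin n → ℝ)}
  {A : (Fin n → ℝ) → ℝ → (Fin n → ℝ) → Mat n} {ψ : (Fin n → ℝ) → ℝ → ℝ → (Fin n → ℝ) → ℝ}

lemma isCompact_QTbar (hΩ : Bornology.IsBounded Ω) : IsCompact (QTbar Ω T) :=
  hΩ.isCompact_closure.prod isCompact_Icc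

lemma exists_jet_bound {X : Type*} [NormedAddCommGroup X] [NormedSpace ℝ X] {G : X → ℝ}
    (hG : ContDiff ℝ 2 G) {S : Set X} (hS : IsCompact S) :
    ∃ c, ∀ y ∈ S, |G y| ≤ c ∧ ‖fderiv ℝ G y‖ ≤ c ∧ ‖fderiv ℝ (fderiv ℝ G) y‖ ≤ c := by
  have h1 : ContDiff ℝ 1 (fderiv ℝ G) := hG.fderiv_right (by norm_num)
  obtain ⟨a, ha⟩ := hS.exists_bound_of_continuousOn hG.continuous.continuousOn
  obtain ⟨b, hb⟩ := hS.exists_bound_of_continuousOn h1.continuous.continuousOn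
  obtain ⟨d, hd⟩ := hS.exists_bound_of_continuousOn
    (h1.continuous_fderiv (by norm_num)).continuousOn
  exact ⟨max a (max b d), fun y hy => ⟨(ha y hy).trans (le_max_left _ _),
    (hb y hy).trans ((le_max_left _ _).trans (le_max_right _ _)),
    (hd y hy).trans ((le_max_right _ _).trans (le_max_right _ _))⟩⟩

lemma exists_coefficient_bound (hΩ : Bornology.IsBounded Ω) (T : ℝ) (hA : ASmooth A)
    (hψ : PsiSmooth ψ) (K : ℝ) :
    ∃ c, 0 ≤ c ∧ ∀ q ∈ QTbar Ω T, ∀ z : ℝ, |z| ≤ K → ∀ p : Fin n → ℝ, ‖p‖ ≤ K →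
      (∀ l m, |entryFun A l m (q, p)| ≤ c ∧ ‖fderiv ℝ (entryFun A l m) (q, p)‖ ≤ c ∧
        ‖fderiv ℝ (fderiv ℝ (entryFun A l m)) (q, p)‖ ≤ c) ∧
      |psiFun ψ (q, (z, p))| ≤ c ∧ ‖fderiv ℝ (psiFun ψ) (q, (z, p))‖ ≤ c ∧
        ‖fderiv ℝ (fderiv ℝ (psiFun ψ)) (q, (z, p))‖ ≤ c := by
  have hB : IsCompact (Metric.closedBall (0 : Fin n → ℝ) K) := isCompact_closedBall _ _
  have hZ : IsCompact (Metric.closedBall (0 : ℝ) K) := isCompact_closedBall _ _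
  have hQ := isCompact_QTbar (T := T) hΩ
  choose a ha using fun l m => exists_jet_bound (G := entryFun A l m)
    (contDiff_infty.1 (hA.2 l m) 2) (hQ.prod hB)
  obtain ⟨b, hb⟩ := exists_jet_bound (G := psiFun ψ) (contDiff_infty.1 hψ 2)
    (hQ.prod (hZ.prod hB))
  have hS : 0 ≤ ∑ l, ∑ m, |a l m| :=
    Finset.sum_nonneg fun l _ => Finset.sum_nonneg fun m _ => abs_nonneg _
  have hal : ∀ l m, a l m ≤ ∑ l, ∑ m, |a l m| + |b| := fun l m => by
    have h1 := Finset.single_le_sum (f := fun m => |a l m|) (fun m _ => abs_nonneg _)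
      (Finset.mem_univ m)
    have h2 := Finset.single_le_sum (f := fun l => ∑ m, |a l m|)
      (fun l _ => Finset.sum_nonneg fun m _ => abs_nonneg _) (Finset.mem_univ l)
    have h3 := le_abs_self (a l m)
    have h4 := abs_nonneg b
    linarith
  have hbl : b ≤ ∑ l, ∑ m, |a l m| + |b| := by linarith [le_abs_self b]
  refine ⟨∑ l, ∑ m, |a l m| + |b|, by positivity, fun q hq z hz p hp => ⟨fun l m => ?_, ?_⟩⟩
  · obtain ⟨h0, h1, h2⟩ := ha l m (q, p) ⟨hq, by simpa using hp⟩
    exact ⟨h0.trans (hal l m), h1.trans (hal l m), h2.trans (hal l m)⟩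
  · obtain ⟨h0, h1, h2⟩ := hb (q, (z, p)) ⟨hq, by simpa using hz, by simpa using hp⟩
    exact ⟨h0.trans hbl, h1.trans hbl, h2.trans hbl⟩

lemma isCompact_orthogonal : IsCompact {Q : Mat n | Q * Qᵀ = 1} := by
  have hK : IsCompact (Set.univ.pi fun _ : Fin n => Set.univ.pi fun _ : Fin n =>
      Set.Icc (-1 : ℝ) 1) :=
    isCompact_univ_pi fun _ => isCompact_univ_pi fun _ => isCompact_Icc
  have hcl : IsClosed {Q : Mat n | Q * Qᵀ = 1} :=
    isClosed_eq (continuous_id.matrix_mul continuous_id.matrix_transpose) continuous_const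
  exact hK.of_isClosed_subset hcl fun Q hQ i _ l _ => abs_le.1 (abs_frame_le hQ i l)

lemma continuous_frameDiag_Umat (hA : ASmooth A) {u : (Fin n → ℝ) → ℝ → ℝ}
    (hu : ContDiff ℝ 2 fun q : (Fin n → ℝ) × ℝ => u q.1 q.2) :
    Continuous fun y : ((Fin n → ℝ) × ℝ) × Mat n => frameDiag y.2 (Umat A u y.1.1 y.1.2) := by
  set g := fun q : (Fin n → ℝ) × ℝ => u q.1 q.2 with hg
  have h1 : ∀ m, ContDiff ℝ ((1 : ℕ) : ℕ∞) (dd (spat (Pi.single m (1 : ℝ))) g) := fun m =>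
    dd_contDiff (k := 1) (by exact_mod_cast hu) _
  have hx : Continuous (xgrad g) := continuous_pi fun l => (h1 l).continuous
  have hU : Continuous fun q : (Fin n → ℝ) × ℝ => Umat A u q.1 q.2 := by
    refine continuous_matrix fun l m => ?_
    have e : (fun q : (Fin n → ℝ) × ℝ => Umat A u q.1 q.2 l m) = fun q =>
        dd (spat (Pi.single l 1)) (dd (spat (Pi.single m 1)) g) q +
          entryFun A l m (q, xgrad g q) := funext fun q => by
      rw [dd_dd_eq_Umat_sub (A := A) hg hu, entryFun]
      ring
    rw [e]
    exact ((dd_contDiff (k := 0) (h1 m) _).continuous).add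
      ((hA.2 l m).continuous.comp (continuous_id.prodMk hx))
  refine continuous_pi fun i => ?_
  have hc := (continuous_snd.matrix_mul (hU.comp continuous_fst)).matrix_mul
    (continuous_snd (X := (Fin n → ℝ) × ℝ) (Y := Mat n)).matrix_transpose
  exact hc.matrix_elem i i

lemma exists_uniform_gap (hΩ : Bornology.IsBounded Ω) (T : ℝ) (hΓ : GoodCone Γ) (hA : ASmooth A)
    {u : (Fin n → ℝ) → ℝ → ℝ} (hu : ContDiff ℝ 2 fun q : (Fin n → ℝ) × ℝ => u q.1 q.2)
    (hadm : Admissible Γ A u (QTbar Ω T)) :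
    ∃ θ > 0, ∀ q ∈ QTbar Ω T, ∀ Q : Mat n, Q * Qᵀ = 1 →
      (fun i => frameDiag Q (Umat A u q.1 q.2) i - θ) ∈ Γ := by
  have hK := ((isCompact_QTbar (T := T) hΩ).prod (isCompact_orthogonal (n := n))).image
    (continuous_frameDiag_Umat hA hu)
  obtain ⟨θ, hθ, hsub⟩ := hK.exists_cthickening_subset_open hΓ.1 (by
    rintro _ ⟨⟨q, Q⟩, ⟨hq, hQ⟩, rfl⟩
    exact frameDiag_mem hΓ hQ (Umat_isSymm hA hu _ _) (hadm q hq))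
  refine ⟨θ, hθ, fun q hq Q hQ => hsub ?_⟩
  refine Metric.mem_cthickening_of_dist_le _ _ _ _ (Set.mem_image_of_mem _
    (show (q, Q) ∈ QTbar Ω T ×ˢ {Q : Mat n | Q * Qᵀ = 1} from ⟨hq, hQ⟩)) ?_
  refine (dist_pi_le_iff hθ.le).2 fun i => ?_
  rw [Real.dist_eq]
  simp [abs_of_pos hθ]

end UniformConstants

/-! ### The global estimate -/

section GlobalEstimate

variable {n : ℕ} {Ω : Set (Fin n → ℝ)} {T : ℝ} {Γ : Set (Fin n → ℝ)} {f : (Fin n → ℝ) → ℝ}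
  {A : (Fin n → ℝ) → ℝ → (Fin n → ℝ) → Mat n} {ψ : (Fin n → ℝ) → ℝ → ℝ → (Fin n → ℝ) → ℝ}
  {u ub : (Fin n → ℝ) → ℝ → ℝ} {g gb : (Fin n → ℝ) × ℝ → ℝ}

lemma frameDiag_le {Q S : Mat n} (hQ : Q * Qᵀ = 1) (hS : S.IsSymm) {r : ℝ}
    (h : ∀ i, eigenVec S i ≤ r) (i : Fin n) : frameDiag Q S i ≤ r := by
  obtain ⟨w, hw0, hw1, hw⟩ := frameDiag_eq_sum_perm hQ hS
  rw [hw, Finset.sum_apply]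
  calc ∑ σ, (w σ • (eigenVec S ∘ σ)) i ≤ ∑ σ, w σ * r :=
        Finset.sum_le_sum fun σ _ => mul_le_mul_of_nonneg_left (h _) (hw0 σ)
    _ = r := by rw [← Finset.sum_mul, hw1, one_mul]

lemma exists_frame_swap {Q : Mat n} (hQ : Q * Qᵀ = 1) (i j : Fin n) :
    ∃ P : Mat n, P * Pᵀ = 1 ∧ ∀ S, frameDiag P S j = frameDiag Q S i := by
  refine ⟨Q.submatrix (Equiv.swap j i) id, ?_, fun S => ?_⟩
  · have : Q.submatrix (Equiv.swap j i) id * (Q.submatrix (Equiv.swap j i) id)ᵀ =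
        (Q * Qᵀ).submatrix (Equiv.swap j i) (Equiv.swap j i) := rfl
    rw [this, hQ, Matrix.submatrix_one_equiv]
  · simp only [frameDiag, frame_apply]
    simp

lemma abs_exponent_le {δ N M K : ℝ} (hδ : 0 ≤ δ) (hN : 0 ≤ N) (hM : 0 ≤ M) (hK : 0 ≤ K)
    {q : (Fin n → ℝ) × ℝ} (hg : |g q| ≤ K) (hgb : |gb q| ≤ K) (hp : ∀ l, |xgrad g q l| ≤ K)
    (ht : q.2 ∈ Set.Icc 0 T) :
    |exponent δ N M g gb q| ≤ δ / 2 * (n * K ^ 2) + N * (2 * K) + M * T := by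
  have h1 : |∑ l, xgrad g q l ^ 2| ≤ n * K ^ 2 := by
    simpa only [sq] using abs_sum_mul_le hK hp hp
  have h2 : |gb q - g q| ≤ 2 * K := (abs_sub _ _).trans (by linarith)
  have h3 : |q.2| ≤ T := abs_le.2 ⟨by linarith [ht.1, ht.2], ht.2⟩
  unfold exponent
  refine (abs_sub _ _).trans (add_le_add ((abs_add_le _ _).trans (add_le_add ?_ ?_)) ?_)
  · rw [abs_mul, abs_of_nonneg (by positivity : 0 ≤ δ / 2)]
    exact mul_le_mul_of_nonneg_left h1 (by positivity)
  · rw [abs_mul, abs_of_nonneg hN]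
    exact mul_le_mul_of_nonneg_left h2 hN
  · rw [abs_mul, abs_of_nonneg hM]
    exact mul_le_mul_of_nonneg_left h3 hM

lemma abs_apply_le_matNorm (S : Mat n) (l m : Fin n) : |S l m| ≤ matNorm S :=
  (norm_le_pi_norm (fun j => S l j) m).trans
    (norm_le_pi_norm (fun i j => S i j : Fin n → Fin n → ℝ) l)

lemma matNorm_le {S : Mat n} {r : ℝ} (hr : 0 ≤ r) (h : ∀ l m, |S l m| ≤ r) : matNorm S ≤ r :=
  (pi_norm_le_iff_of_nonneg hr).2 fun l => (pi_norm_le_iff_of_nonneg hr).2 fun m => h l m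

/-- The largest eigenvalue of `U` controls the Hessian. -/
lemma hessian_bound_of_eigenvalue_bound (hn : 0 < n) (hΓ : GoodCone Γ) (hA : ASmooth A)
    (hu : ContDiff ℝ 2 fun q : (Fin n → ℝ) × ℝ => u q.1 q.2) {q : (Fin n → ℝ) × ℝ}
    (hadm : eigenVec (Umat A u q.1 q.2) ∈ Γ) {c r : ℝ}
    (hA0 : ∀ l m, |A q.1 q.2 (sgrad (fun y => u y q.2) q.1) l m| ≤ c)
    (hr : ∀ i, eigenVec (Umat A u q.1 q.2) i ≤ r) :
    matNorm (shess (fun y => u y q.2) q.1) ≤ n * (n * r) + c := by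
  obtain ⟨Q, hQ, hQU⟩ := exists_eigenframe (Umat_isSymm hA hu q.1 q.2)
  have : Nonempty (Fin n) := ⟨⟨0, hn⟩⟩
  obtain ⟨i₀, hi₀⟩ := Finite.exists_max (eigenVec (Umat A u q.1 q.2))
  have h1 := abs_le_mul_of_sum_pos (sum_pos_of_mem hn hΓ hadm) hi₀
  have h2 : ∀ i, |eigenVec (Umat A u q.1 q.2) i| ≤ n * r := fun i =>
    (h1 i).trans (mul_le_mul_of_nonneg_left (hr i₀) (Nat.cast_nonneg n))
  have h3 : ∀ l m, |shess (fun y => u y q.2) q.1 l m| ≤ n * (n * r) + c := fun l m => by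
    have e : shess (fun y => u y q.2) q.1 l m =
        Umat A u q.1 q.2 l m - A q.1 q.2 (sgrad (fun y => u y q.2) q.1) l m := by
      simp [Umat]
    rw [e]
    exact (abs_sub _ _).trans (add_le_add (abs_entry_le hQ hQU h2 l m) (hA0 l m))
  exact matNorm_le ((abs_nonneg _).trans (h3 i₀ i₀)) h3

/-- The Hessian controls the diagonal of `U` in any orthonormal frame. -/
lemma frameDiag_Umat_le {Q : Mat n} (hQ : Q * Qᵀ = 1) {q : (Fin n → ℝ) × ℝ} {c R : ℝ}
    (hA0 : ∀ l m, |A q.1 q.2 (sgrad (fun y => u y q.2) q.1) l m| ≤ c)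
    (hR : matNorm (shess (fun y => u y q.2) q.1) ≤ R) (i : Fin n) :
    frameDiag Q (Umat A u q.1 q.2) i ≤ n ^ 2 * (R + c) := by
  have h : ∀ l m, ‖Umat A u q.1 q.2 l m‖ ≤ R + c := fun l m =>
    (norm_add_le _ _).trans (add_le_add ((abs_apply_le_matNorm _ l m).trans hR) (hA0 l m))
  have h1 := norm_frame_sum_le hQ i i h
  refine le_trans (le_of_eq ?_) ((le_abs_self _).trans h1)
  rw [frameDiag, frame_apply]
  exact Finset.sum_congr rfl fun l _ => Finset.sum_congr rfl fun m _ => by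
    rw [smul_eq_mul]; ring

lemma mem_QT_of_not_mem_PQ (hΩ : IsOpen Ω) {q : (Fin n → ℝ) × ℝ} (hq : q ∈ QTbar Ω T)
    (hP : q ∉ PQ Ω T) : q ∈ QT Ω T := by
  obtain ⟨hx, ht⟩ := hq
  have h1 : q.2 ≠ 0 := fun h => hP (Or.inl ⟨hx, h⟩)
  have h2 : q.1 ∉ frontier Ω := fun h => hP (Or.inr ⟨h, ht⟩)
  refine ⟨?_, lt_of_le_of_ne ht.1 h1.symm, ht.2⟩
  by_contra h
  exact h2 ⟨hx, by rwa [hΩ.interior_eq]⟩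

/-- The largest eigenvalue of `U` is bounded by its bounds at the maximum points of
`U_{ξξ} exp η`. -/
lemma eigenvalue_bound_of_max (hΩ : Bornology.IsBounded Ω) (hA : ASmooth A)
    (hu : ContDiff ℝ 2 fun q : (Fin n → ℝ) × ℝ => u q.1 q.2) {η : (Fin n → ℝ) × ℝ → ℝ}
    (hη : Continuous η) {B r : ℝ} (hB : ∀ q ∈ QTbar Ω T, |η q| ≤ B) (hr0 : 0 ≤ r)
    (hr : ∀ q ∈ QTbar Ω T, ∀ Q : Mat n, Q * Qᵀ = 1 →
      Q * Umat A u q.1 q.2 * Qᵀ = Matrix.diagonal (eigenVec (Umat A u q.1 q.2)) →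
      ∀ i₀, (∀ i, eigenVec (Umat A u q.1 q.2) i ≤ eigenVec (Umat A u q.1 q.2) i₀) →
      (∀ q' ∈ QTbar Ω T, (Q * Umat A u q'.1 q'.2 * Qᵀ) i₀ i₀ * Real.exp (η q') ≤
        (Q * Umat A u q.1 q.2 * Qᵀ) i₀ i₀ * Real.exp (η q)) →
      eigenVec (Umat A u q.1 q.2) i₀ ≤ r)
    {q : (Fin n → ℝ) × ℝ} (hq : q ∈ QTbar Ω T) (i : Fin n) :
    eigenVec (Umat A u q.1 q.2) i ≤ r * Real.exp (2 * B) := by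
  have hK := (isCompact_QTbar (T := T) hΩ).prod (isCompact_orthogonal (n := n))
  set G : ((Fin n → ℝ) × ℝ) × Mat n → ℝ := fun y =>
    frameDiag y.2 (Umat A u y.1.1 y.1.2) i * Real.exp (η y.1) with hG
  have hGc : Continuous G := ((continuous_apply i).comp (continuous_frameDiag_Umat hA hu)).mul
    (Real.continuous_exp.comp (hη.comp continuous_fst))
  obtain ⟨⟨q₀, Q₀⟩, ⟨hq₀, hQ₀⟩, hmax⟩ := hK.exists_isMaxOn
    ⟨(q, 1), hq, by simp⟩ hGc.continuousOn
  have hmax' : ∀ q' ∈ QTbar Ω T, ∀ Q : Mat n, Q * Qᵀ = 1 → ∀ j,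
      frameDiag Q (Umat A u q'.1 q'.2) j * Real.exp (η q') ≤ G (q₀, Q₀) := fun q' hq' Q hQ j => by
    obtain ⟨P, hP, hPS⟩ := exists_frame_swap hQ j i
    have := hmax (show (q', P) ∈ QTbar Ω T ×ˢ {Q : Mat n | Q * Qᵀ = 1} from ⟨hq', hP⟩)
    rw [← hPS]
    exact this
  have hsymm := fun q : (Fin n → ℝ) × ℝ => Umat_isSymm hA hu q.1 q.2
  obtain ⟨Q, hQ, hQU⟩ := exists_eigenframe (hsymm q₀)
  have : Nonempty (Fin n) := ⟨i⟩
  obtain ⟨i₀, hi₀⟩ := Finite.exists_max (eigenVec (Umat A u q₀.1 q₀.2))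
  have hdiag : (Q * Umat A u q₀.1 q₀.2 * Qᵀ) i₀ i₀ = eigenVec (Umat A u q₀.1 q₀.2) i₀ := by
    simp [hQU]
  have htop : G (q₀, Q₀) ≤ (Q * Umat A u q₀.1 q₀.2 * Qᵀ) i₀ i₀ * Real.exp (η q₀) := by
    rw [hdiag]
    exact mul_le_mul_of_nonneg_right (frameDiag_le hQ₀ (hsymm q₀) hi₀ i) (Real.exp_pos _).le
  have hb := hr q₀ hq₀ Q hQ hQU i₀ hi₀ fun q' hq' => (hmax' q' hq' Q hQ i₀).trans htop
  obtain ⟨P, hP, hPU⟩ := exists_eigenframe (hsymm q)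
  have h1 := (hmax' q hq P hP i).trans htop
  have h2 : frameDiag P (Umat A u q.1 q.2) i = eigenVec (Umat A u q.1 q.2) i := by
    simp [frameDiag, hPU]
  rw [h2, hdiag] at h1
  have h3 : eigenVec (Umat A u q.1 q.2) i * Real.exp (η q) ≤ r * Real.exp B :=
    h1.trans (mul_le_mul hb (Real.exp_le_exp.2 (abs_le.1 (hB _ hq₀)).2) (Real.exp_pos _).le hr0)
  have h4 : eigenVec (Umat A u q.1 q.2) i =
      eigenVec (Umat A u q.1 q.2) i * Real.exp (η q) * Real.exp (-η q) := by
    rw [mul_assoc, ← Real.exp_add, add_neg_cancel, Real.exp_zero, mul_one]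
  rw [h4]
  calc _ ≤ r * Real.exp B * Real.exp (-η q) :=
        mul_le_mul_of_nonneg_right h3 (Real.exp_pos _).le
    _ ≤ r * Real.exp B * Real.exp B := by
        have := (abs_le.1 (hB _ hq)).1
        have hrB : 0 ≤ r * Real.exp B := mul_nonneg hr0 (Real.exp_pos _).le
        exact mul_le_mul_of_nonneg_left (Real.exp_le_exp.2 (by linarith)) hrB
    _ = r * Real.exp (2 * B) := by rw [mul_assoc, ← Real.exp_add, two_mul]

end GlobalEstimate

/-- global second-derivative estimate, Theorem 1.1 first part,
flat case: `max_{Q̄_T} |D²u| ≤ C₁ (1 + max_{𝒫Q_T} |D²u|)`. -/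
theorem statement1
    {n : ℕ} (hn : 2 ≤ n)
    (Ω : Set (Fin n → ℝ)) (hΩo : IsOpen Ω) (hΩb : Bornology.IsBounded Ω)
    (hΩs : SmoothBoundary Ω)
    (T : ℝ) (hT : 0 < T)
    (Γ : Set (Fin n → ℝ)) (hΓ : GoodCone Γ)
    (f : (Fin n → ℝ) → ℝ) (hfs : SmoothSymF Γ f) (hf1 : F1cond Γ f) (hf2 : F2cond Γ f)
    (hf5 : F5cond Γ f)
    (A : (Fin n → ℝ) → ℝ → (Fin n → ℝ) → Mat n) (hA : ASmooth A)
    (ψ : (Fin n → ℝ) → ℝ → ℝ → (Fin n → ℝ) → ℝ) (hψ : PsiSmooth ψ)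
    (hA2 : A2cond A ψ) (hA4 : A4cond ψ)
    (δ₀ : ℝ) (hδ₀ : 0 < δ₀) :
    ∀ K > 0, ∃ C₁ > 0, ∀ u ub : (Fin n → ℝ) → ℝ → ℝ,
      RegN 4 u → Admissible Γ A u (QTbar Ω T) → SolvesE f A ψ u (QT Ω T) →
      RegN 2 ub → Subsol Γ f A ψ δ₀ ub (QTbar Ω T) →
      C1xBound u (QTbar Ω T) K → C2Bound ub (QTbar Ω T) K →
      ∀ R : ℝ, (∀ q ∈ PQ Ω T, matNorm (shess (fun y => u y q.2) q.1) ≤ R) →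
        ∀ q ∈ QTbar Ω T, matNorm (shess (fun y => u y q.2) q.1) ≤ C₁ * (1 + R) := by
  intro K hK
  have hn0 : 0 < n := by omega
  have hn1 : (1 : ℝ) ≤ n := by exact_mod_cast hn0
  obtain ⟨c₀, hc₀, hcoef⟩ := exists_coefficient_bound hΩb T hA hψ K
  by_cases hex : ∃ ub, RegN 2 ub ∧ Admissible Γ A ub (QTbar Ω T) ∧ C2Bound ub (QTbar Ω T) K
  swap
  · exact ⟨1, one_pos, fun u ub _ _ _ hub hsub _ hKb => absurd ⟨ub, hub, hsub.1, hKb⟩ hex⟩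
  obtain ⟨ub, hub, hadmb, hKb⟩ := hex
  have hgb : ContDiff ℝ 2 fun q : (Fin n → ℝ) × ℝ => ub q.1 q.2 := by exact_mod_cast hub
  obtain ⟨θ, hθ, hgap⟩ := exists_uniform_gap hΩb T hΓ hA hgb hadmb
  obtain ⟨c, hc⟩ : ∃ c, c = n ^ 2 * c₀ + K + 1 := ⟨_, rfl⟩
  have hn2 : (1 : ℝ) ≤ n ^ 2 := one_le_pow₀ hn1
  have hc0c : n ^ 2 * c₀ ≤ c := by linarith
  have hc0c' : c₀ ≤ c := (le_mul_of_one_le_left hc₀ hn2).trans hc0c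
  have hKc : K ≤ c := by nlinarith
  have hc1 : 1 ≤ c := by nlinarith
  obtain ⟨C, hC⟩ : ∃ C, C = 6 * n ^ 3 * c ^ 2 := ⟨_, rfl⟩
  have hC1 : 1 ≤ 12 * C ^ 3 := by
    have h1 : (1 : ℝ) ≤ n ^ 3 * c ^ 2 := one_le_mul_of_one_le_of_one_le (one_le_pow₀ hn1)
      (one_le_pow₀ hc1)
    have h2 : 1 ≤ C ^ 3 := one_le_pow₀ (by linarith)
    linarith
  obtain ⟨δ, N, M, Λ, hδ, hδ1, hN, hM, hΛ1, hΛ⟩ := exists_final_constants n hC1 hθ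
  obtain ⟨B, hBdef⟩ : ∃ B, B = δ / 2 * (n * c ^ 2) + N * (2 * c) + M * T := ⟨_, rfl⟩
  refine ⟨n * (n * ((Λ + n ^ 2 * (1 + c)) * Real.exp (2 * B))) + c, by positivity, ?_⟩
  intro u _ hu hadm hE _ _ hK1 _ R hR q hq
  obtain ⟨g, hg⟩ : ∃ g, g = fun q : (Fin n → ℝ) × ℝ => u q.1 q.2 := ⟨_, rfl⟩
  obtain ⟨gb, hgbu⟩ : ∃ gb, gb = fun q : (Fin n → ℝ) × ℝ => ub q.1 q.2 := ⟨_, rfl⟩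
  have hg4 : ContDiff ℝ ((4 : ℕ) : ℕ∞) g := hg ▸ hu
  have hg2 : ContDiff ℝ 2 g := contDiff_two_of_nat (by norm_num) hg4
  have hgb2 : ContDiff ℝ 2 gb := hgbu ▸ hgb
  have hgrad : ∀ q : (Fin n → ℝ) × ℝ, sgrad (fun y => u y q.2) q.1 = xgrad g q := fun q => by
    rw [sgrad_eq_xgrad _ _ (hg ▸ hg2.differentiable (by norm_num) _), hg]
  have hgradb : ∀ q : (Fin n → ℝ) × ℝ, sgrad (fun y => ub y q.2) q.1 = xgrad gb q := fun q => by
    rw [sgrad_eq_xgrad _ _ (hgbu ▸ hgb2.differentiable (by norm_num) _), hgbu]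
  have hu0 : ∀ q ∈ QTbar Ω T, |g q| ≤ K ∧ ‖xgrad g q‖ ≤ K := fun q hq => by
    have h := hK1 q hq
    rw [hgrad] at h
    have h1 : |u q.1 q.2| = |g q| := by rw [hg]
    constructor <;> linarith [abs_nonneg (g q), norm_nonneg (xgrad g q)]
  have hub0 : ∀ q ∈ QTbar Ω T, |gb q| ≤ K ∧ ‖xgrad gb q‖ ≤ K ∧ |dd timeVec gb q| ≤ K :=
    fun q hq => by
      have h := hKb q hq
      rw [hgradb, deriv_time _ _ (hgbu ▸ hgb2.differentiable (by norm_num) _), ← hgbu] at h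
      have h1 : |ub q.1 q.2| = |gb q| := by rw [hgbu]
      have h2 : 0 ≤ matNorm (shess (fun y => ub y q.2) q.1) := norm_nonneg _
      refine ⟨?_, ?_, ?_⟩ <;>
        linarith [abs_nonneg (gb q), norm_nonneg (xgrad gb q), abs_nonneg (dd timeVec gb q)]
  have hp : ∀ q ∈ QTbar Ω T, ∀ l, |xgrad g q l| ≤ c := fun q hq l =>
    ((norm_le_pi_norm (xgrad g q) l).trans (hu0 q hq).2).trans hKc
  have hpb : ∀ q ∈ QTbar Ω T, ∀ l, |xgrad gb q l| ≤ c := fun q hq l =>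
    ((norm_le_pi_norm (xgrad gb q) l).trans (hub0 q hq).2.1).trans hKc
  have hA0 : ∀ q ∈ QTbar Ω T, ∀ l m, |A q.1 q.2 (xgrad g q) l m| ≤ c := fun q hq l m =>
    (((hcoef q hq _ (hu0 q hq).1 _ (hu0 q hq).2).1 l m).1).trans hc0c'
  have hA0' : ∀ q ∈ QTbar Ω T, ∀ l m, |A q.1 q.2 (sgrad (fun y => u y q.2) q.1) l m| ≤ c :=
    fun q hq => by rw [hgrad]; exact hA0 q hq
  have hB : ∀ q ∈ QTbar Ω T, |exponent δ N M g gb q| ≤ B := fun q hq => hBdef ▸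
    abs_exponent_le hδ.le hN hM (by linarith) ((hu0 q hq).1.trans hKc)
      ((hub0 q hq).1.trans hKc) (hp q hq) hq.2
  have hR0 : 0 ≤ R := (norm_nonneg _).trans (hR (q.1, 0) (Or.inl ⟨hq.1, rfl⟩))
  have hr0 : 0 ≤ n ^ 2 * (R + c) := by positivity
  have key := fun i => eigenvalue_bound_of_max hΩb hA (hg ▸ hg2) (η := exponent δ N M g gb)
    (exponent_contDiff hg4 hgb2).continuous hB (r := Λ + n ^ 2 * (R + c)) (by linarith)
    (fun q hq Q hQ hQU i₀ htop hmax => by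
      by_cases hP : q ∈ PQ Ω T
      · have h := frameDiag_Umat_le hQ (hA0' q hq) (hR q hP) i₀
        rw [frameDiag, hQU, Matrix.diagonal_apply_eq] at h
        linarith
      · have hco := hcoef q hq _ (hu0 q hq).1 _ (hu0 q hq).2
        have hfr := norm_fderiv_frameEntry_le hA hQ (fun l m => (hco.1 l m).2.1)
          (fun l m => (hco.1 l m).2.2)
        have h := interior_estimate hn0 hΓ hfs hf1 hf2 hf5 hA hψ hA2 hΩo hg hg4 hgbu hgb2 hadm hE
          (mem_QT_of_not_mem_PQ hΩo hq hP) hQ rfl hQU htop hc1 hC hδ hδ1 hN hΛ1 hΛ hmax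
          (hA0 q hq) (fun j k => (hfr j k).1.trans hc0c) (fun j k => (hfr j k).2.trans hc0c)
          (hco.2.1.trans hc0c') (hco.2.2.1.trans hc0c') (hco.2.2.2.trans hc0c') (hp q hq)
          (hpb q hq) ((hub0 q hq).2.2.trans hKc) (hgap q hq Q hQ)
        linarith)
    hq i
  refine (hessian_bound_of_eigenvalue_bound hn0 hΓ hA (hg ▸ hg2) (hadm q hq) (hA0' q hq) key).trans
    ?_
  have h1 : Λ + n ^ 2 * (R + c) ≤ (Λ + n ^ 2 * (1 + c)) * (1 + R) := by
    have h2 : 0 ≤ Λ * R := by positivity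
    have h3 : 0 ≤ (n : ℝ) ^ 2 * c * R := by positivity
    have h4 : (0 : ℝ) ≤ n ^ 2 := by positivity
    linarith
  calc n * (n * ((Λ + n ^ 2 * (R + c)) * Real.exp (2 * B))) + c
      ≤ n * (n * ((Λ + n ^ 2 * (1 + c)) * (1 + R) * Real.exp (2 * B))) + c * (1 + R) := by
        have hcR : c ≤ c * (1 + R) := le_mul_of_one_le_right (by linarith) (by linarith)
        gcongr
    _ = _ := by ring

end ParabolicHessian
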